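/- arXiv:1906.02621 — 4 statements merged into one kernel-verified Lean document; each statement's English description precedes it below -/
import Mathlib

section
/- There exists a binary linear code of length 46, dimension 9, and minimum Hamming distance 20; that is, a 9-dimensional linear subspace C of (F_2)^46 in which every nonzero codeword has Hamming weight at least 20 and some codeword has Hamming weight exactly 20. -/
namespace BinaryCode

/-- The vector in `(F_2)^n` whose `j`-th coordinate is the `j`-th binary digit of `a`. -/
def ofBits (n a : ℕ) : Fin n → ZMod 2 := fun j => if a.testBit j then 1 else 0

theorem ofBits_zero (n : ℕ) : ofBits n 0 = 0 := by
  ext j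
  simp [ofBits]

theorem ofBits_xor (n a b : ℕ) : ofBits n (a ^^^ b) = ofBits n a + ofBits n b := by
  ext j
  simp only [ofBits, Nat.testBit_xor, Pi.add_apply]
  cases a.testBit j <;> cases b.testBit j <;> decide

/-- The number of nonzero digits among the first `n` binary digits of `a`. -/
def weight (n a : ℕ) : ℕ := (List.range n).countP fun j => a.testBit j

theorem hammingNorm_ofBits (n a : ℕ) : hammingNorm (ofBits n a) = weight n a := by
  have h : ∀ j : Fin n, (ofBits n a j ≠ 0) ↔ a.testBit j = true := fun j => by simp [ofBits]
  simp only [hammingNorm, h, weight]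
  rw [Finset.card_filter, Fin.sum_univ_eq_sum_range (fun j => if a.testBit j = true then 1 else 0)]
  induction n with
  | zero => rfl
  | succ n ih =>
    rw [Finset.sum_range_succ, ih fun j => by simp [ofBits], List.range_succ, List.countP_append,
      List.countP_singleton]

/-- All sums modulo 2 of sublists of `l`, with vectors encoded by their binary digits. -/
def xorSums : List ℕ → List ℕ
  | [] => [0]
  | a :: l => xorSums l ++ (xorSums l).map (a ^^^ ·)

theorem exists_xorSums_of_mem_span {n : ℕ} (l : List ℕ) {x : Fin n → ZMod 2}
    (hx : x ∈ Submodule.span (ZMod 2) (ofBits n '' {a | a ∈ l})) :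
    ∃ a ∈ xorSums l, ofBits n a = x := by
  induction l generalizing x with
  | nil =>
    have h : x = 0 := by simpa using hx
    exact ⟨0, by simp [xorSums], by rw [h, ofBits_zero]⟩
  | cons b l ih =>
    have h : {a | a ∈ b :: l} = insert b {a | a ∈ l} := by ext; simp
    rw [h, Set.image_insert_eq, Submodule.mem_span_insert] at hx
    obtain ⟨r, z, hz, rfl⟩ := hx
    obtain ⟨a, ha, rfl⟩ := ih hz
    have hr : r = 0 ∨ r = 1 := by revert r; decide
    obtain rfl | rfl := hr
    · exact ⟨a, List.mem_append_left _ ha, by simp⟩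
    · exact ⟨b ^^^ a, List.mem_append_right _ (List.mem_map_of_mem ha), by simp [ofBits_xor]⟩

/-- The rows of a systematic generator matrix of a `[46, 9, 20]` code, read as binary numbers. -/
def generators : List ℕ :=
  [ 41080728635648,
    68535386216576,
    56366866655808,
    29298887635488,
    16404168644112,
    28171166748168,
    8276467056132,
    545462943234,
    4294966785]

theorem weight_of_mem_xorSums_generators :
    ∀ a ∈ xorSums generators, a = 0 ∨ 20 ≤ weight 46 a := by
  decide +kernel

theorem linearIndependent_generators :
    LinearIndependent (ZMod 2) fun i : Fin 9 => ofBits 46 (generators.get i) := by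
  apply LinearIndependent.of_comp
    (LinearMap.funLeft (ZMod 2) (ZMod 2) fun i : Fin 9 => Fin.castLE (by norm_num : 9 ≤ 46) i.rev)
  convert (Pi.basisFun (ZMod 2) (Fin 9)).linearIndependent using 1
  have h : ∀ i j : Fin 9, ofBits 46 (generators.get i) (Fin.castLE (by norm_num) j.rev) =
      (Pi.single i 1 : Fin 9 → ZMod 2) j := by
    decide +kernel
  ext i j
  simpa [LinearMap.funLeft_apply] using h i j

end BinaryCode

open BinaryCode

/-- There exists a binary linear `[46, 9, 20]` code: a 9-dimensional subspace of
`(F_2)^46` in which every nonzero codeword has Hamming weight at least 20 and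
some codeword has Hamming weight exactly 20. -/
theorem exists_46_9_20_code :
    ∃ C : Submodule (ZMod 2) (Fin 46 → ZMod 2),
      Module.finrank (ZMod 2) C = 9 ∧
      (∀ c ∈ C, c ≠ 0 → 20 ≤ hammingNorm c) ∧
      (∃ c ∈ C, hammingNorm c = 20) := by
  have himage : ofBits 46 '' {a | a ∈ generators} =
      Set.range fun i : Fin 9 => ofBits 46 (generators.get i) := by
    rw [← Set.range_list_get, ← Set.range_comp]
    rfl
  refine ⟨Submodule.span (ZMod 2) (ofBits 46 '' {a | a ∈ generators}), ?_, ?_, ?_⟩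
  · rw [himage, finrank_span_eq_card linearIndependent_generators, Fintype.card_fin]
  · intro c hc hc0
    obtain ⟨a, ha, rfl⟩ := exists_xorSums_of_mem_span generators hc
    rw [hammingNorm_ofBits]
    refine (weight_of_mem_xorSums_generators a ha).resolve_left ?_
    rintro rfl
    exact hc0 (ofBits_zero 46)
  · refine ⟨ofBits 46 (generators.get (0 : Fin 9)), ?_, ?_⟩
    · exact Submodule.subset_span ⟨_, List.get_mem _ _, rfl⟩
    · rw [hammingNorm_ofBits]
      decide +kernel
end

section
/- Every binary linear code of length n at most 16 and dimension 4 in which every nonzero codeword has Hamming weight at least 7 contains a codeword of Hamming weight exactly 8. -/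
open Finset in
/-- On a finite binary vector space, a linear functional is nonzero on at most half the vectors. -/
theorem two_mul_card_filter_linearMap_ne_zero_le {V : Type*} [AddCommGroup V]
    [Module (ZMod 2) V] [Fintype V] (g : V →ₗ[ZMod 2] ZMod 2) :
    2 * #{v : V | g v ≠ 0} ≤ Fintype.card V := by
  have hsplit := card_filter_add_card_filter_not (s := (univ : Finset V)) (fun v => g v ≠ 0)
  rw [card_univ] at hsplit
  suffices h : #{v : V | g v ≠ 0} ≤ #{v : V | ¬ g v ≠ 0} by omega
  by_cases hg : ∃ w, g w ≠ 0
  · obtain ⟨w, hw⟩ := hg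
    refine card_le_card_of_injOn (· + w) (fun v hv => ?_) ((add_left_injective w).injOn)
    have hv' : g v ≠ 0 := by simpa using hv
    have key : ∀ a b : ZMod 2, a ≠ 0 → b ≠ 0 → a + b = 0 := by decide
    simpa using key _ _ hv' hw
  · push Not at hg
    simp [hg]

open Finset in
/-- The Plotkin averaging bound: the mean weight of a binary linear code is at most half its
length. -/
theorem two_mul_sum_hammingNorm_le {ι V : Type*} [Fintype ι] [AddCommGroup V]
    [Module (ZMod 2) V] [Fintype V] (f : V →ₗ[ZMod 2] (ι → ZMod 2)) :
    2 * ∑ v, hammingNorm (f v) ≤ Fintype.card ι * Fintype.card V := by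
  have hswap : ∑ v, hammingNorm (f v) = ∑ i, #{v : V | f v i ≠ 0} := by
    simp only [hammingNorm, card_filter]
    exact sum_comm
  rw [hswap, mul_sum, ← smul_eq_mul (Fintype.card ι), ← card_univ (α := ι)]
  exact sum_le_card_nsmul _ _ _ fun i _ =>
    two_mul_card_filter_linearMap_ne_zero_le (LinearMap.proj i ∘ₗ f)

/-- The parity of the weight of a binary word is the sum of its coordinates. -/
theorem natCast_hammingNorm_zmod_two {ι : Type*} [Fintype ι] (c : ι → ZMod 2) :
    (hammingNorm c : ZMod 2) = ∑ i, c i := by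
  have key : ∀ a : ZMod 2, (if a ≠ 0 then 1 else 0) = a := by decide
  simp only [hammingNorm, Finset.card_filter, Nat.cast_sum, Nat.cast_ite, Nat.cast_one,
    Nat.cast_zero, key]

/-- Every binary linear code of length at most 16 and dimension 4 in which every
nonzero codeword has Hamming weight at least 7 contains a codeword of Hamming
weight exactly 8. -/
theorem code_le16_4_7_has_weight_eight
    (n : ℕ) (hn : n ≤ 16)
    (C : Submodule (ZMod 2) (Fin n → ZMod 2))
    (hdim : Module.finrank (ZMod 2) C = 4)
    (hmin : ∀ c ∈ C, c ≠ 0 → 7 ≤ hammingNorm c) :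
    ∃ c ∈ C, hammingNorm c = 8 := by
  classical
  by_contra! hne
  let parity : C →ₗ[ZMod 2] ZMod 2 := (∑ i, LinearMap.proj i) ∘ₗ C.subtype
  let E := LinearMap.ker parity
  have hrank : Module.finrank (ZMod 2) (LinearMap.range parity) +
      Module.finrank (ZMod 2) E = Module.finrank (ZMod 2) C :=
    parity.finrank_range_add_finrank_ker
  have hrange := Submodule.finrank_le (LinearMap.range parity)
  rw [Module.finrank_self] at hrange
  have : Fintype E := Fintype.ofFinite E
  have hcard : 8 ≤ Fintype.card E := by
    rw [Module.card_eq_pow_finrank (K := ZMod 2), ZMod.card]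
    exact Nat.pow_le_pow_right (n := 2) (i := 3) (by norm_num) (by omega)
  have hweight : ∀ v : E, v ≠ 0 → 10 ≤ hammingNorm (v : Fin n → ZMod 2) := by
    intro v hv
    have heven : Even (hammingNorm (v : Fin n → ZMod 2)) := by
      rw [← ZMod.natCast_eq_zero_iff_even, natCast_hammingNorm_zmod_two]
      have hker : parity v = 0 := v.2
      simpa only [parity, LinearMap.comp_apply, LinearMap.sum_apply, LinearMap.proj_apply,
        Submodule.subtype_apply] using hker
    have h7 := hmin v v.1.2 (by simpa using hv)
    have h8 := hne v v.1.2
    obtain ⟨k, hk⟩ := heven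
    omega
  have hupper := two_mul_sum_hammingNorm_le (C.subtype ∘ₗ E.subtype)
  have hlower : (Fintype.card E - 1) * 10 ≤
      ∑ v : E, hammingNorm ((C.subtype ∘ₗ E.subtype) v) := by
    rw [← Finset.add_sum_erase _ _ (Finset.mem_univ (0 : E)), ← Finset.card_univ,
      ← Finset.card_erase_of_mem (Finset.mem_univ (0 : E)), ← smul_eq_mul]
    exact le_add_left (Finset.card_nsmul_le_sum _ _ _ fun v hv =>
      hweight v (Finset.ne_of_mem_erase hv))
  have hlen := Nat.mul_le_mul_right (Fintype.card E) hn
  rw [Fintype.card_fin] at hupper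
  omega
end

section
/- Every binary linear code C of length 118 and dimension 10 in which every nonzero codeword has Hamming weight at least 56 and the Hamming weight of every codeword is even has one of the following two weight distributions, where A_i denotes the number of codewords of Hamming weight i: either A_0 = 1, A_56 = 719, A_64 = 218, A_72 = 85, A_80 = 1, and A_i = 0 for all other i; or A_0 = 1, A_56 = 720, A_64 = 215, A_72 = 88, and A_i = 0 for all other i. -/
namespace EvenCode
open Finset

section PositiveDefinite

variable {V : Type*} [AddCommGroup V]

/-- A multiplicative integer-valued function with value `1` at zero. -/
def IsSign (χ : V → ℤ) : Prop := χ 0 = 1 ∧ ∀ x y, χ (x + y) = χ x * χ y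

/-- Finite sums of sign characters. -/
inductive PD : (V → ℤ) → Prop
  | sign {χ : V → ℤ} (h : IsSign χ) : PD χ
  | zero : PD fun _ => 0
  | add {f g : V → ℤ} (hf : PD f) (hg : PD g) : PD fun x => f x + g x

theorem IsSign.one : IsSign (fun _ : V => 1) := ⟨rfl, fun _ _ => rfl⟩

theorem IsSign.mul {χ ψ : V → ℤ} (h : IsSign χ) (k : IsSign ψ) :
    IsSign fun x => χ x * ψ x :=
  ⟨by simp [h.1, k.1], fun x y => by simp only [h.2, k.2]; ring⟩

theorem PD.sign_mul {χ f : V → ℤ} (h : IsSign χ) (hf : PD f) : PD fun x => χ x * f x := by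
  induction hf with
  | sign k => exact .sign (h.mul k)
  | zero => simpa using PD.zero
  | add _ _ ihf ihg => simpa [mul_add] using ihf.add ihg

theorem PD.mul {f g : V → ℤ} (hf : PD f) (hg : PD g) : PD fun x => f x * g x := by
  induction hf with
  | sign k => exact hg.sign_mul k
  | zero => simpa using PD.zero
  | add _ _ ihf ihg => simpa [add_mul] using ihf.add ihg

theorem PD.smul {f : V → ℤ} (hf : PD f) {a : ℤ} (ha : 0 ≤ a) : PD fun x => a * f x := by
  lift a to ℕ using ha
  induction a with
  | zero => simpa using PD.zero
  | succ n ih => simpa [add_mul] using ih.add hf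

theorem PD.sum {κ : Type*} (s : Finset κ) {f : κ → V → ℤ} (h : ∀ i ∈ s, PD (f i)) :
    PD fun x => ∑ i ∈ s, f i x := by
  classical
  induction s using Finset.induction_on with
  | empty => simpa using PD.zero
  | insert a s ha ih =>
    simp only [Finset.sum_insert ha]
    exact (h a (by simp)).add (ih fun i hi => h i (by simp [hi]))

theorem IsSign.comp {W : Type*} [AddCommGroup W] {χ : V → ℤ} (h : IsSign χ) (l : W →+ V) :
    IsSign fun x => χ (l x) :=
  ⟨by simp [h.1], fun x y => by simp [h.2]⟩

theorem PD.comp {W : Type*} [AddCommGroup W] {f : V → ℤ} (hf : PD f) (l : W →+ V) :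
    PD fun x => f (l x) := by
  induction hf with
  | sign k => exact .sign (k.comp l)
  | zero => exact .zero
  | add _ _ ihf ihg => exact ihf.add ihg

theorem IsSign.mul_self [Module (ZMod 2) V] {χ : V → ℤ} (h : IsSign χ) (x : V) :
    χ x * χ x = 1 := by
  rw [← h.2, ZModModule.add_self, h.1]

theorem IsSign.sum_eq [Fintype V] {χ : V → ℤ} (h : IsSign χ) :
    (∀ x, χ x = 1) ∨ ∑ x, χ x = 0 := by
  by_cases hx : ∀ x, χ x = 1
  · exact .inl hx
  · push Not at hx
    obtain ⟨a, ha⟩ := hx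
    right
    have := Equiv.sum_comp (Equiv.addRight a) χ
    simp only [Equiv.coe_addRight, h.2, ← Finset.sum_mul] at this
    have h2 : (∑ x, χ x) * (χ a - 1) = 0 := by linarith
    rcases mul_eq_zero.1 h2 with h | h
    · exact h
    · exact absurd (by linarith) ha

theorem PD.sum_eq [Fintype V] {f : V → ℤ} (hf : PD f) :
    ∃ k : ℕ, ∑ x, f x = Fintype.card V * k := by
  induction hf with
  | sign k =>
    rcases k.sum_eq with h | h
    · exact ⟨1, by simp [h]⟩
    · exact ⟨0, by simp [h]⟩
  | zero => exact ⟨0, by simp⟩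
  | add _ _ ihf ihg =>
    obtain ⟨a, ha⟩ := ihf
    obtain ⟨b, hb⟩ := ihg
    exact ⟨a + b, by rw [Finset.sum_add_distrib, ha, hb]; push_cast; ring⟩

theorem PD.sum_nonneg [Fintype V] {f : V → ℤ} (hf : PD f) : 0 ≤ ∑ x, f x := by
  obtain ⟨k, hk⟩ := hf.sum_eq
  rw [hk]; positivity

end PositiveDefinite

section Quadratic

variable {V : Type*} [AddCommGroup V] [Module (ZMod 2) V]

/-- A `±1`-valued function of degree two. -/
structure QuadSign (Q : V → ℤ) : Prop where
  zero : Q 0 = 1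
  mul_self : ∀ x, Q x * Q x = 1
  polar : ∀ x, IsSign fun y => Q (x + y) * Q x * Q y

/-- The radical of a quadratic sign function. -/
def QuadSign.radical {Q : V → ℤ} (h : QuadSign Q) : Submodule (ZMod 2) V :=
  AddSubgroup.toZModSubmodule 2
  { carrier := {x | ∀ y, Q (x + y) = Q x * Q y}
    zero_mem' := fun y => by simp [h.zero]
    add_mem' := fun {a b} ha hb y => by
      rw [add_assoc, ha, hb, ha, mul_assoc]
    neg_mem' := fun {a} ha => by rwa [ZModModule.neg_eq_self a] }

theorem QuadSign.mem_radical {Q : V → ℤ} (h : QuadSign Q) {x : V} :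
    x ∈ h.radical ↔ ∀ y, Q (x + y) = Q x * Q y := Iff.rfl

omit [Module (ZMod 2) V] in
theorem QuadSign.eq_or {Q : V → ℤ} (h : QuadSign Q) (x : V) : Q x = 1 ∨ Q x = -1 :=
  mul_self_eq_one_iff.1 (h.mul_self x)

theorem QuadSign.mul_sign {Q χ : V → ℤ} (h : QuadSign Q) (k : IsSign χ) :
    QuadSign fun x => Q x * χ x where
  zero := by simp [h.zero, k.1]
  mul_self x := by
    linear_combination h.mul_self x * (χ x * χ x) + k.mul_self x
  polar x := by
    convert h.polar x using 2 with y
    rw [k.2]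
    linear_combination Q (x + y) * Q x * Q y * (χ y * χ y * k.mul_self x + k.mul_self y)

theorem QuadSign.radical_mul_sign {Q χ : V → ℤ} (h : QuadSign Q) (k : IsSign χ) :
    (h.mul_sign k).radical = h.radical := by
  ext x
  simp only [QuadSign.mem_radical, k.2]
  refine forall_congr' fun y => ⟨fun e => ?_, fun e => by rw [e]; ring⟩
  have h1 := k.mul_self x
  have h2 := k.mul_self y
  linear_combination (χ x * χ y) * e + (Q x * Q y - Q (x + y)) * (χ y * χ y * h1 + h2)

/-- A quadratic sign function agrees on its radical with a sign character. -/
theorem QuadSign.exists_sign {Q : V → ℤ} (h : QuadSign Q) :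
    ∃ χ : V → ℤ, IsSign χ ∧ ∀ x ∈ h.radical, χ x = Q x := by
  let sgn : ZMod 2 → ℤ := fun a => if a = 0 then 1 else -1
  have sgn_add : ∀ a b, sgn (a + b) = sgn a * sgn b := by decide
  let f0 : h.radical →+ ZMod 2 :=
    { toFun := fun x => if Q x = 1 then 0 else 1
      map_zero' := by simp [h.zero]
      map_add' := fun x y => by
        have := h.mem_radical.1 x.2 y
        simp only [Submodule.coe_add, this]
        rcases h.eq_or x with hx | hx <;> rcases h.eq_or y with hy | hy <;> simp [hx, hy]
        decide }
  obtain ⟨f, hf⟩ := (f0.toZModLinearMap 2).exists_extend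
  refine ⟨fun x => sgn (f x), ⟨by simp [sgn], fun x y => by simp only [map_add, sgn_add]⟩, fun x hx => ?_⟩
  have h1 : f x = if Q x = 1 then 0 else 1 := DFunLike.congr_fun hf ⟨x, hx⟩
  simp only [h1, sgn]
  rcases h.eq_or x with hx | hx <;> simp [hx]

variable [Fintype V]

omit [Module (ZMod 2) V] in
theorem QuadSign.sum_mul_polar {Q : V → ℤ} (h : QuadSign Q) (c : V) :
    ∑ x, Q x * (Q (x + c) * Q x * Q c) = Q c * ∑ x, Q x := by
  rw [← Equiv.sum_comp (Equiv.addRight c) Q, Finset.mul_sum]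
  refine Finset.sum_congr rfl fun x _ => ?_
  simp only [Equiv.coe_addRight]
  linear_combination Q (x + c) * Q c * h.mul_self x

open Classical in
theorem QuadSign.sum_polar {Q : V → ℤ} (h : QuadSign Q) (c : V) :
    ∑ x, (Q (x + c) * Q x * Q c) = if c ∈ h.radical then (Fintype.card V : ℤ) else 0 := by
  have key : ∀ x, (Q (x + c) * Q x * Q c) = Q (c + x) * Q c * Q x := fun x => by
    rw [add_comm]; ring
  simp only [key]
  split_ifs with hc
  · rw [Finset.sum_congr rfl (g := fun _ => 1)]
    · simp
    · intro x _
      rw [h.mem_radical.1 hc]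
      linear_combination (Q x * Q x) * h.mul_self c + h.mul_self x
  · rcases (h.polar c).sum_eq with h1 | h1
    · refine absurd (h.mem_radical.2 fun y => ?_) hc
      have := h1 y
      linear_combination (Q c * Q y) * this - Q (c + y) * ((Q y * Q y) * h.mul_self c + h.mul_self y)
    · exact h1

open Classical in
theorem QuadSign.sq_sum {Q : V → ℤ} (h : QuadSign Q) (h1 : ∀ x ∈ h.radical, Q x = 1) :
    (∑ x, Q x) ^ 2 = Fintype.card V * Nat.card h.radical := by
  have e1 : (∑ x, Q x) ^ 2 = ∑ c, ∑ x, Q x * (Q (x + c) * Q x * Q c) := by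
    simp only [h.sum_mul_polar, ← Finset.sum_mul]; ring
  rw [e1, Finset.sum_comm]
  have e2 : ∀ x, ∑ c, Q x * (Q (x + c) * Q x * Q c) =
      if x ∈ h.radical then (Fintype.card V : ℤ) else 0 := fun x => by
    rw [← Finset.mul_sum]
    have : ∑ c, Q (x + c) * Q x * Q c = ∑ c, Q (c + x) * Q c * Q x :=
      Finset.sum_congr rfl fun c _ => by rw [add_comm]; ring
    rw [this, h.sum_polar]
    split_ifs with hx
    · simp [h1 x hx]
    · simp
  simp only [e2]
  rw [← Finset.sum_filter, Finset.sum_const, nsmul_eq_mul, mul_comm, Nat.card_eq_fintype_card,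
    Fintype.card_subtype]

open Classical in
/-- Structure of quadratic sign functions: Gauss sums and positive definiteness. -/
theorem QuadSign.structure {Q : V → ℤ} (h : QuadSign Q) :
    ∃ t : ℕ, t ^ 2 * Nat.card h.radical = Fintype.card V ∧
      (∀ f : V → ℤ, PD f →
        0 ≤ ∑ x, Q x * (t * (if x ∈ h.radical then 1 else 0) + 1) * f x ∧
        0 ≤ ∑ x, Q x * (t * (if x ∈ h.radical then 1 else 0) - 1) * f x) ∧
      (((∀ x ∈ h.radical, Q x = 1) ∧
          (t * ∑ x, Q x = Fintype.card V ∨ t * ∑ x, Q x = -(Fintype.card V : ℤ))) ∨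
        (∑ x, Q x = 0 ∧ ∑ x, Q x * (if x ∈ h.radical then 1 else 0) = 0)) := by
  obtain ⟨χ, hχ, hχQ⟩ := h.exists_sign
  have h' := h.mul_sign hχ
  have hr : h'.radical = h.radical := h.radical_mul_sign hχ
  have hQ' : ∀ x ∈ h'.radical, Q x * χ x = 1 := fun x hx => by
    rw [hr] at hx; rw [hχQ x hx, h.mul_self]
  have hsq := h'.sq_sum hQ'
  rw [hr] at hsq
  obtain ⟨S, hS⟩ : ∃ S, S = ∑ x, Q x * χ x := ⟨_, rfl⟩
  rw [← hS] at hsq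
  have hV : 0 < Fintype.card V := Fintype.card_pos
  have hR : 0 < Nat.card h.radical := Nat.card_pos
  have hRV : Nat.card h.radical ∣ Fintype.card V := by
    rw [← Nat.card_eq_fintype_card]
    exact AddSubgroup.card_addSubgroup_dvd_card h.radical.toAddSubgroup
  have hsqn : S.natAbs ^ 2 = Fintype.card V * Nat.card h.radical := by
    zify; rw [sq_abs]; exact_mod_cast hsq
  have hdvd : S.natAbs ∣ Fintype.card V := by
    rw [← Nat.pow_dvd_pow_iff two_ne_zero, hsqn, sq]
    exact Nat.mul_dvd_mul_left _ hRV
  obtain ⟨t, ht⟩ := hdvd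
  have hSpos : 0 < S.natAbs := Nat.pos_of_ne_zero fun h0 => by simp [h0] at ht
  have htR : t ^ 2 * Nat.card h.radical = Fintype.card V := by
    have : (Fintype.card V) * (t ^ 2 * Nat.card h.radical) = Fintype.card V * Fintype.card V := by
      calc _ = t ^ 2 * (Fintype.card V * Nat.card h.radical) := by ring
        _ = t ^ 2 * S.natAbs ^ 2 := by rw [hsqn]
        _ = _ := by rw [← sq (Fintype.card V), ht]; ring
    exact Nat.eq_of_mul_eq_mul_left hV this
  have key : ∀ ε : ℤ, (ε = 1 ∨ ε = -1) → ∀ f : V → ℤ, PD f →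
      0 ≤ ∑ x, (Fintype.card V * (if x ∈ h.radical then 1 else 0) + ε * S * (Q x * χ x)) *
        (χ x * f x) := by
    intro ε hε f hf
    have pd : PD fun c => ∑ x, (1 + ε * (Q x * χ x)) *
        ((Q (x + c) * χ (x + c)) * (Q x * χ x) * (Q c * χ c)) := by
      refine PD.sum _ fun x _ => PD.smul (.sign (h'.polar x)) ?_
      rcases hε with rfl | rfl <;> rcases h'.eq_or x with hx | hx <;> simp [hx]
    have := (pd.mul (hf.sign_mul hχ)).sum_nonneg
    convert this using 3 with c
    simp only [add_mul, Finset.sum_add_distrib, one_mul]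
    rw [h'.sum_polar, hr]
    have e := h'.sum_mul_polar c
    simp only [mul_assoc] at e ⊢
    rw [← Finset.mul_sum, e, ← hS]
    split_ifs <;> ring
  have key2 : ∀ ε : ℤ, (ε = 1 ∨ ε = -1) → ∀ f : V → ℤ, PD f →
      0 ≤ ∑ x, Q x * (t * (if x ∈ h.radical then 1 else 0) + ε) * f x := by
    intro ε hε f hf
    obtain ⟨δ, hδ, hδS⟩ : ∃ δ : ℤ, (δ = 1 ∨ δ = -1) ∧ δ * S = S.natAbs := by
      rcases le_total 0 S with h0 | h0
      · exact ⟨1, .inl rfl, by simp [abs_of_nonneg h0]⟩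
      · exact ⟨-1, .inr rfl, by simp [abs_of_nonpos h0]⟩
    have hk := key (ε * δ) (by rcases hε with rfl | rfl <;> rcases hδ with rfl | rfl <;> simp) f hf
    have e : ∑ x, (Fintype.card V * (if x ∈ h.radical then 1 else 0) +
        ε * δ * S * (Q x * χ x)) * (χ x * f x) =
        S.natAbs * ∑ x, Q x * (t * (if x ∈ h.radical then 1 else 0) + ε) * f x := by
      rw [Finset.mul_sum]
      refine Finset.sum_congr rfl fun x _ => ?_
      rw [mul_assoc ε, hδS, ht]
      push_cast
      split_ifs with hx
      · rw [hχQ x hx]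
        linear_combination ε * |S| * Q x * f x * h.mul_self x
      · linear_combination ε * |S| * Q x * f x * hχ.mul_self x
    rw [e] at hk
    exact nonneg_of_mul_nonneg_right hk (by exact_mod_cast hSpos)
  refine ⟨t, htR, fun f hf => ⟨key2 1 (.inl rfl) f hf, ?_⟩, ?_⟩
  · simpa [sub_eq_add_neg] using key2 (-1) (.inr rfl) f hf
  have shift : ∀ r ∈ h.radical, ∑ x, Q x = Q r * ∑ x, Q x := fun r hr => by
    refine (Equiv.sum_comp (Equiv.addLeft r) Q).symm.trans ?_
    rw [Finset.mul_sum]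
    exact Finset.sum_congr rfl fun x _ => h.mem_radical.1 hr x
  by_cases hall : ∀ x ∈ h.radical, Q x = 1
  · left
    refine ⟨hall, ?_⟩
    have h2 := h.sq_sum hall
    rw [← mul_self_eq_mul_self_iff]
    have : (t : ℤ) ^ 2 * Nat.card h.radical = Fintype.card V := by exact_mod_cast htR
    linear_combination (t : ℤ) ^ 2 * h2 + (Fintype.card V : ℤ) * this
  · right
    push Not at hall
    obtain ⟨r, hrm, hr1⟩ := hall
    have hrQ : Q r = -1 := (h.eq_or r).resolve_left hr1
    constructor
    · have := shift r hrm
      rw [hrQ] at this; linarith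
    · have e := Equiv.sum_comp (Equiv.addLeft r) fun x => Q x * (if x ∈ h.radical then 1 else 0)
      have : ∀ x, Q (r + x) * (if r + x ∈ h.radical then 1 else 0) =
          -(Q x * (if x ∈ h.radical then 1 else 0)) := fun x => by
        rw [h.mem_radical.1 hrm, hrQ, Submodule.add_mem_iff_right _ hrm]; ring
      have e' := (Finset.sum_congr rfl fun x _ => this x).symm.trans e
      rw [Finset.sum_neg_distrib] at e'
      linarith

end Quadratic

section Coordinates

variable {ι : Type*}

/-- The number of nonzero coordinates of `c` in `K`. -/
def cnt (K : Finset ι) (c : ι → ZMod 2) : ℕ := #{k ∈ K | c k ≠ 0}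

/-- The sum of the signs of the coordinates of `c` in `K`. -/
def cs (K : Finset ι) (c : ι → ZMod 2) : ℤ := #K - 2 * cnt K c

theorem cnt_add (K : Finset ι) (x y : ι → ZMod 2) :
    cnt K (x + y) + 2 * cnt {k ∈ K | x k ≠ 0} y = cnt K x + cnt K y := by
  have key : ∀ a b : ZMod 2, (if a + b ≠ 0 then 1 else 0) +
      2 * (if a ≠ 0 then if b ≠ 0 then 1 else 0 else 0) =
        (if a ≠ 0 then 1 else 0) + (if b ≠ 0 then 1 else 0) := by decide
  simp only [cnt, Finset.card_filter, Finset.sum_filter, Finset.mul_sum, ← Finset.sum_add_distrib]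
  exact Finset.sum_congr rfl fun k _ => key (x k) (y k)

@[simp] theorem cnt_zero (K : Finset ι) : cnt K (0 : ι → ZMod 2) = 0 := by simp [cnt]

theorem cnt_le (K : Finset ι) (c : ι → ZMod 2) : cnt K c ≤ #K := Finset.card_filter_le _ _

theorem isSign_coord (k : ι) :
    IsSign fun c : ι → ZMod 2 => if c k = 0 then (1 : ℤ) else -1 := by
  have key : ∀ a b : ZMod 2, (if a + b = 0 then (1 : ℤ) else -1) =
      (if a = 0 then 1 else -1) * (if b = 0 then 1 else -1) := by decide
  exact ⟨by simp, fun x y => key (x k) (y k)⟩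

theorem cs_insert [DecidableEq ι] {K : Finset ι} {k : ι} (hk : k ∉ K) (c : ι → ZMod 2) :
    cs (insert k K) c = cs K c + if c k = 0 then 1 else -1 := by
  simp only [cs, cnt, Finset.filter_insert, Finset.card_insert_of_notMem hk]
  by_cases h : c k = 0
  · simp only [h, ne_eq, not_true_eq_false, if_false, if_true]; push_cast; ring
  · simp only [h, ne_eq, not_false_eq_true, if_false, if_true]
    rw [Finset.card_insert_of_notMem (by simp [hk])]; push_cast; ring

theorem pd_cs_all (K : Finset ι) :
    PD (cs K) ∧ PD (fun c => cs K c ^ 2 - #K) ∧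
      PD (fun c => cs K c ^ 3 - (3 * #K - 2) * cs K c) := by
  classical
  induction K using Finset.induction_on with
  | empty =>
    have e : cs (∅ : Finset ι) = fun _ => 0 := by ext c; simp [cs, cnt]
    simpa [e] using PD.zero
  | insert k K hk ih =>
    obtain ⟨h1, h2, h3⟩ := ih
    have hs := isSign_coord k
    refine ⟨?_, ?_, ?_⟩
    · convert h1.add (.sign hs) using 2 with c
      exact cs_insert hk c
    · convert h2.add ((h1.sign_mul hs).smul (a := 2) (by norm_num)) using 2 with c
      rw [cs_insert hk c, Finset.card_insert_of_notMem hk]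
      push_cast
      linear_combination hs.mul_self c
    · convert h3.add ((h2.sign_mul hs).smul (a := 3) (by norm_num)) using 2 with c
      rw [cs_insert hk c, Finset.card_insert_of_notMem hk]
      have := hs.mul_self c
      generalize (if c k = 0 then (1 : ℤ) else -1) = χ at *
      push_cast
      linear_combination (3 * cs K c + χ) * this

theorem isSign_cnt (K : Finset ι) :
    IsSign fun c : ι → ZMod 2 => if Even (cnt K c) then (1 : ℤ) else -1 := by
  refine ⟨by simp, fun x y => ?_⟩
  have h := cnt_add K x y
  have : Even (cnt K (x + y)) ↔ (Even (cnt K x) ↔ Even (cnt K y)) := by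
    simp only [Nat.even_iff]; omega
  simp only [this]
  by_cases h1 : Even (cnt K x) <;> by_cases h2 : Even (cnt K y) <;> simp [h1, h2]

theorem quadSign_cnt (K : Finset ι) (V : Submodule (ZMod 2) (ι → ZMod 2))
    (h : ∀ x ∈ V, Even (cnt K x)) :
    QuadSign fun x : V => if 4 ∣ cnt K (x : ι → ZMod 2) then (1 : ℤ) else -1 where
  zero := by simp
  mul_self x := by split_ifs <;> rfl
  polar x := by
    convert (isSign_cnt {k ∈ K | (x : ι → ZMod 2) k ≠ 0}).comp V.subtype.toAddMonoidHom
      using 2 with y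
    have e := cnt_add K x y
    have e1 := Nat.even_iff.1 (h x x.2)
    have e2 := Nat.even_iff.1 (h y y.2)
    simp only [Submodule.coe_add, LinearMap.toAddMonoidHom_coe, Submodule.subtype_apply,
      Nat.even_iff]
    by_cases h1 : 4 ∣ cnt K x <;> by_cases h2 : 4 ∣ cnt K y <;>
      by_cases h3 : 4 ∣ cnt K (x + y : ι → ZMod 2) <;> simp only [h1, h2, h3, if_true, if_false] <;>
      split_ifs <;> first | rfl | omega

end Coordinates

section Codes

variable {ι : Type*}

/-- The elements of a binary linear code, as a finset. -/
noncomputable def words [Finite ι] (D : Submodule (ZMod 2) (ι → ZMod 2)) :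
    Finset (ι → ZMod 2) := (Set.toFinite (D : Set (ι → ZMod 2))).toFinset

@[simp] theorem mem_words [Finite ι] {D : Submodule (ZMod 2) (ι → ZMod 2)} {x : ι → ZMod 2} :
    x ∈ words D ↔ x ∈ D := by simp [words]

theorem sum_words [Finite ι] (D : Submodule (ZMod 2) (ι → ZMod 2)) [Fintype D]
    (f : (ι → ZMod 2) → ℤ) : ∑ x ∈ words D, f x = ∑ x : D, f x :=
  Finset.sum_subtype _ (fun _ => mem_words) f

theorem card_words [Finite ι] (D : Submodule (ZMod 2) (ι → ZMod 2)) [Fintype D] :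
    #(words D) = Fintype.card D :=
  (Fintype.card_of_subtype (words D) fun _ => mem_words).symm

theorem PD.sum_words_eq [Finite ι] {f : (ι → ZMod 2) → ℤ} (hf : PD f)
    (D : Submodule (ZMod 2) (ι → ZMod 2)) : ∃ k : ℕ, ∑ x ∈ words D, f x = #(words D) * k := by
  have := Fintype.ofFinite D
  rw [sum_words, card_words]
  exact (hf.comp D.subtype.toAddMonoidHom).sum_eq

theorem PD.sum_words_nonneg [Finite ι] {f : (ι → ZMod 2) → ℤ} (hf : PD f)
    (D : Submodule (ZMod 2) (ι → ZMod 2)) : 0 ≤ ∑ x ∈ words D, f x := by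
  obtain ⟨k, hk⟩ := hf.sum_words_eq D
  rw [hk]; positivity

/-- The sign `(-1) ^ (cnt K x / 2)`, for words meeting `K` evenly. -/
def qsign (K : Finset ι) (x : ι → ZMod 2) : ℤ := if 4 ∣ cnt K x then 1 else -1

theorem qsign_eq_or (K : Finset ι) (x : ι → ZMod 2) : qsign K x = 1 ∨ qsign K x = -1 := by
  unfold qsign; split_ifs <;> simp

open Classical in
/-- The indicator function of the radical of `qsign K` on `D`. -/
noncomputable def rind (K : Finset ι) (D : Submodule (ZMod 2) (ι → ZMod 2)) (x : ι → ZMod 2) : ℤ :=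
  if ∀ z ∈ D, qsign K (x + z) = qsign K x * qsign K z then 1 else 0

theorem rind_eq_one {K : Finset ι} {D : Submodule (ZMod 2) (ι → ZMod 2)} {x : ι → ZMod 2} :
    rind K D x = 1 ↔ ∀ z ∈ D, qsign K (x + z) = qsign K x * qsign K z := by
  simp [rind]

theorem rind_eq_or (K : Finset ι) (D : Submodule (ZMod 2) (ι → ZMod 2)) (x : ι → ZMod 2) :
    rind K D x = 0 ∨ rind K D x = 1 := by
  unfold rind; split_ifs <;> simp

/-- The type of the quadratic form `cnt K x / 2` on `D`: its Gauss sum and the positive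
definiteness of the associated functions. -/
theorem exists_type [Finite ι] (K : Finset ι) (D : Submodule (ZMod 2) (ι → ZMod 2))
    (h : ∀ x ∈ D, Even (cnt K x)) :
    ∃ t : ℕ, t ^ 2 * ∑ x ∈ words D, rind K D x = #(words D) ∧
      (∀ f : (ι → ZMod 2) → ℤ, PD f →
        0 ≤ ∑ x ∈ words D, qsign K x * (t * rind K D x + 1) * f x ∧
        0 ≤ ∑ x ∈ words D, qsign K x * (t * rind K D x - 1) * f x) ∧
      (((∀ x ∈ D, rind K D x = 1 → qsign K x = 1) ∧
          (t * ∑ x ∈ words D, qsign K x = #(words D) ∨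
            t * ∑ x ∈ words D, qsign K x = -(#(words D) : ℤ))) ∨
        (∑ x ∈ words D, qsign K x = 0 ∧
          ∑ x ∈ words D, rind K D x * qsign K x = 0)) := by
  classical
  have := Fintype.ofFinite D
  have hQ := quadSign_cnt K D h
  have hmem : ∀ x : D, (if x ∈ hQ.radical then 1 else 0) = rind K D x := fun x => by
    rw [rind]
    refine if_congr ?_ rfl rfl
    rw [hQ.mem_radical]
    exact ⟨fun e z hz => e ⟨z, hz⟩, fun e z => e z z.2⟩
  have hcard : ∑ x ∈ words D, rind K D x = Nat.card hQ.radical := by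
    rw [sum_words, Nat.card_eq_fintype_card, Fintype.card_subtype]
    simp only [← hmem, Finset.sum_boole]
  obtain ⟨t, h1, h2, h3⟩ := hQ.structure
  refine ⟨t, by rw [hcard, card_words, ← h1]; push_cast; rfl, fun f hf => ?_, ?_⟩
  · simp only [sum_words, ← hmem]
    exact h2 _ (hf.comp D.subtype.toAddMonoidHom)
  · have hS : ∑ x ∈ words D, qsign K x =
        ∑ x : D, (if 4 ∣ cnt K (x : ι → ZMod 2) then (1 : ℤ) else -1) := sum_words _ _
    rw [hS, card_words]
    rcases h3 with ⟨h3, h4⟩ | ⟨h3, h4⟩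
    · refine .inl ⟨fun x hx hx1 => ?_, h4⟩
      have := hmem ⟨x, hx⟩
      rw [hx1] at this
      exact h3 ⟨x, hx⟩ (by by_contra hn; simp [hn] at this)
    · refine .inr ⟨h3, ?_⟩
      rw [sum_words, ← h4]
      refine Finset.sum_congr rfl fun x _ => ?_
      rw [hmem, qsign, mul_comm]

theorem cnt_univ_eq [Fintype ι] [DecidableEq ι] (K : Finset ι) (x : ι → ZMod 2) :
    cnt univ x = cnt K x + cnt Kᶜ x := by
  unfold cnt
  rw [← Finset.card_union_of_disjoint, ← Finset.filter_union, Finset.union_compl]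
  exact Finset.disjoint_filter_filter disjoint_compl_right

theorem cnt_univ_eq_zero [Fintype ι] {x : ι → ZMod 2} (h : cnt univ x = 0) : x = 0 := by
  ext k
  by_contra hk
  rw [cnt, Finset.card_eq_zero] at h
  have : k ∈ ({k ∈ univ | x k ≠ 0} : Finset ι) := by simpa using hk
  simp [h] at this

/-- The support of a word. -/
def supp [Fintype ι] (y : ι → ZMod 2) : Finset ι := {k | y k ≠ 0}

theorem cnt_add_supp [Fintype ι] (x y : ι → ZMod 2) :
    cnt univ (x + y) + 2 * cnt (supp y) x = cnt univ x + cnt univ y := by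
  have : cnt univ (y + x) + 2 * cnt (supp y) x = cnt univ y + cnt univ x := cnt_add univ y x
  rw [add_comm x y]; omega

theorem filter_supp [Fintype ι] (y : ι → ZMod 2) : {k ∈ supp y | y k ≠ 0} = supp y := by
  simp [supp, Finset.filter_filter]

theorem cnt_supp_self [Fintype ι] (y : ι → ZMod 2) : cnt (supp y) y = cnt univ y := by
  rw [cnt, filter_supp]; rfl

theorem cnt_supp_compl_self [Fintype ι] [DecidableEq ι] (y : ι → ZMod 2) :
    cnt (supp y)ᶜ y = 0 := by
  have := cnt_univ_eq (supp y) y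
  rw [cnt_supp_self] at this; omega

end Codes

section WeightSixtyEight

/-- A test polynomial in the intersection numbers of a word with a word of weight 68 and with
the complement of that word. -/
def base68 (a b c d e i j : ℤ) : ℤ :=
  a * (50 - 2 * j) + b * ((50 - 2 * j) ^ 2 - 50) + c * ((50 - 2 * j) ^ 3 - 148 * (50 - 2 * j)) +
    (d + e * (50 - 2 * j)) * ((68 - 2 * i) ^ 2 - 68)

/-- The polynomial by which the quadratic sign is multiplied in `Cert68`. -/
def twist68 (p q j : ℤ) : ℤ := p * (50 - 2 * j) + q * ((50 - 2 * j) ^ 2 - 50)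

/-- A linear programming certificate for codes with a word of weight 68: the test function is
bounded by a function of the quadratic sign and of the indicator of the radical. -/
structure Cert68 (t a b c d e p q al be ga de k : ℤ) : Prop where
  nonneg : (0 ≤ a ∧ 0 ≤ b ∧ 0 ≤ c) ∧ (0 ≤ d ∧ 0 ≤ e) ∧ 0 ≤ p ∧ 0 ≤ q
  even : ∀ i : ℕ, i < 69 → 2 ∣ i → ∀ j : ℕ, j < 51 →
    4 ∣ i + j ∧ 56 ≤ i + j ∧ 56 + i ≤ 68 + j → ∀ Q ∈ [if 4 ∣ i then (1 : ℤ) else -1],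
      base68 a b c d e i j + Q * twist68 p q j ≤ al + be * Q ∧
      base68 a b c d e i j + Q * (t + 1) * twist68 p q j ≤ al + be * Q + ga + de * Q
  odd : ∀ i : ℕ, i < 69 → ¬ 2 ∣ i → ∀ j : ℕ, j < 51 →
    2 ∣ i + j ∧ 56 ≤ i + j ∧ 56 + i ≤ 68 + j → base68 a b c d e i j ≤ k

set_option synthInstance.maxHeartbeats 400000 in
set_option synthInstance.maxSize 1000 in
instance (t a b c d e p q al be ga de k : ℤ) : Decidable (Cert68 t a b c d e p q al be ga de k) :=
  decidable_of_iff (_ ∧ _ ∧ _) ⟨fun h => ⟨h.1, h.2.1, h.2.2⟩, fun h => ⟨h.nonneg, h.even, h.odd⟩⟩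


section

variable {C D : Submodule (ZMod 2) (Fin 118 → ZMod 2)} {y : Fin 118 → ZMod 2}
  {Y : Finset (Fin 118)}

theorem pd_base68 (hY : #Y = 68) {a b c d e : ℤ} (ha : 0 ≤ a) (hb : 0 ≤ b) (hc : 0 ≤ c)
    (hd : 0 ≤ d) (he : 0 ≤ e) :
    PD fun x : Fin 118 → ZMod 2 => base68 a b c d e (cnt Y x) (cnt Yᶜ x) := by
  obtain ⟨h1, h2, h3⟩ := pd_cs_all Yᶜ
  obtain ⟨-, g2, -⟩ := pd_cs_all Y
  have hY' : #Yᶜ = 50 := by rw [Finset.card_compl, hY]; rfl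
  have := (((h1.smul ha).add (h2.smul hb)).add (h3.smul hc)).add
    (((PD.sign IsSign.one).smul hd).add (h1.smul he) |>.mul g2)
  convert this using 2 with x
  simp only [base68, cs, hY, hY']
  push_cast
  ring

theorem pd_twist68 (hY : #Y = 68) {p q : ℤ} (hp : 0 ≤ p) (hq : 0 ≤ q) :
    PD fun x : Fin 118 → ZMod 2 => twist68 p q (cnt Yᶜ x) := by
  obtain ⟨h1, h2, -⟩ := pd_cs_all Yᶜ
  have hY' : #Yᶜ = 50 := by rw [Finset.card_compl, hY]; rfl
  convert (h1.smul hp).add (h2.smul hq) using 2 with x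
  simp only [twist68, cs, hY']
  push_cast
  ring

theorem rind_supp_self {ι : Type*} [Fintype ι] {D : Submodule (ZMod 2) (ι → ZMod 2)}
    {y : ι → ZMod 2} (hy : 4 ∣ cnt univ y) (hD : ∀ x ∈ D, Even (cnt (supp y) x)) :
    rind (supp y) D y = 1 :=
  rind_eq_one.2 fun z hz => by
    have e := cnt_add (supp y) y z
    rw [filter_supp, cnt_supp_self] at e
    have e' := Nat.even_iff.1 (hD z hz)
    have : 4 ∣ cnt (supp y) (y + z) ↔ 4 ∣ cnt (supp y) z := by omega
    simp [qsign, this, cnt_supp_self, hy]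

theorem Cert68.not_code (hC : #(words C) = 1024)
    (hmin : ∀ x ∈ C, x ≠ 0 → 56 ≤ cnt univ x) (heven : ∀ x ∈ C, 2 ∣ cnt univ x)
    (hyC : y ∈ C) (hy : cnt univ y = 68) (hYy : Y = supp y)
    (hD : ∀ x, x ∈ D ↔ x ∈ C ∧ Even (cnt Y x)) (hD4 : ∀ x ∈ D, 4 ∣ cnt univ x)
    {t : ℕ} {a b c d e p q al be ga de k : ℤ}
    (cert : Cert68 t a b c d e p q al be ga de k)
    (ht : ∀ f : (Fin 118 → ZMod 2) → ℤ, PD f →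
      0 ≤ ∑ x ∈ words D, qsign Y x * (t * rind Y D x + 1) * f x)
    (hlt : al * #(words D) + be * ∑ x ∈ words D, qsign Y x + ga * ∑ x ∈ words D, rind Y D x +
      de * ∑ x ∈ words D, rind Y D x * qsign Y x + k * (1024 - #(words D)) +
      2 * (base68 a b c d e 0 0 + (t + 1) * twist68 p q 0 - (al + be + ga + de)) < 0) : False := by
  classical
  have hY : #Y = 68 := by rw [hYy]; exact hy
  have hyY : cnt Y y = 68 := by rw [hYy, cnt_supp_self, hy]
  have hyY' : cnt Yᶜ y = 0 := by rw [hYy, cnt_supp_compl_self]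
  have hYc : #Yᶜ = 50 := by rw [Finset.card_compl, hY]; rfl
  have hy0 : y ≠ 0 := by rintro rfl; simp at hy
  have hyD : y ∈ D := (hD y).2 ⟨hyC, by rw [hyY]; decide⟩
  obtain ⟨K, hK⟩ : ∃ K, K = base68 a b c d e 0 0 + (t + 1) * twist68 p q 0 - (al + be + ga + de) :=
    ⟨_, rfl⟩
  have hF := (pd_base68 hY cert.nonneg.1.1 cert.nonneg.1.2.1 cert.nonneg.1.2.2 cert.nonneg.2.1.1
    cert.nonneg.2.1.2).sum_words_nonneg C
  have hT := ht _ (pd_twist68 hY cert.nonneg.2.2.1 cert.nonneg.2.2.2)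
  have hDC : words D = {x ∈ words C | Even (cnt Y x)} := by ext x; simp [hD]
  rw [← Finset.sum_filter_add_sum_filter_not (words C) (fun x => Even (cnt Y x)), ← hDC] at hF
  have hcard := Finset.card_filter_add_card_filter_not (s := words C) (fun x => Even (cnt Y x))
  rw [← hDC, hC] at hcard
  have hwt : ∀ x ∈ C, x ≠ 0 → x ≠ y → cnt Y x < 69 ∧ cnt Yᶜ x < 51 ∧
      56 ≤ cnt Y x + cnt Yᶜ x ∧ 56 + cnt Y x ≤ 68 + cnt Yᶜ x := fun x hx h0 h1 => by
    have e1 := hmin x hx h0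
    have e2 := hmin (x + y) (C.add_mem hx hyC) fun h => h1 (by
      rwa [← ZModModule.sub_eq_add, sub_eq_zero] at h)
    have e3 := cnt_add_supp x y
    rw [← hYy] at e3
    have e4 := cnt_univ_eq Y x
    have e5 := cnt_le Y x
    have e6 := cnt_le Yᶜ x
    omega
  have hodd : ∑ x ∈ words C with ¬ Even (cnt Y x),
      base68 a b c d e (cnt Y x) (cnt Yᶜ x) ≤ (1024 - #(words D)) * k := by
    refine (Finset.sum_le_card_nsmul _ _ k fun x hx => ?_).trans_eq ?_
    · rw [Finset.mem_filter, mem_words] at hx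
      obtain ⟨hx, hx2⟩ := hx
      have h2 := heven x hx
      rw [cnt_univ_eq Y x] at h2
      have hw := hwt x hx (by rintro rfl; simp at hx2)
        (by rintro rfl; rw [hyY] at hx2; exact hx2 (by decide))
      exact cert.odd _ hw.1 (by rwa [← even_iff_two_dvd]) _ hw.2.1 ⟨h2, hw.2.2⟩
    · rw [nsmul_eq_mul]; congr 1; omega
  have hev : ∀ x ∈ words D, base68 a b c d e (cnt Y x) (cnt Yᶜ x) +
      qsign Y x * (t * rind Y D x + 1) * twist68 p q (cnt Yᶜ x) ≤
      al + be * qsign Y x + ga * rind Y D x + de * (rind Y D x * qsign Y x) +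
        ((if x = 0 then K else 0) + if x = y then K else 0) := fun x hx => by
    rw [mem_words] at hx
    by_cases h0 : x = 0
    · subst h0
      have h1 : rind Y D 0 = 1 := rind_eq_one.2 fun z _ => by simp [qsign]
      rw [if_pos rfl, if_neg hy0.symm, h1, hK]
      simp only [cnt_zero, qsign, dvd_zero, if_true, Nat.cast_zero]
      apply le_of_eq; ring
    by_cases h1 : x = y
    · subst h1
      have h1 : rind Y D x = 1 := by
        rw [hYy]
        exact rind_supp_self (by rw [hy]; decide) fun z hz => hYy ▸ ((hD z).1 hz).2
      rw [if_pos rfl, if_neg h0, h1, hK]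
      simp only [qsign, hyY, hyY', show 4 ∣ 68 by decide, if_true, Nat.cast_zero]
      apply le_of_eq
      simp only [base68]
      push_cast
      ring
    · obtain ⟨hxC, hx2⟩ := (hD x).1 hx
      have hw := hwt x hxC h0 h1
      have h4 := hD4 x hx
      rw [cnt_univ_eq Y x] at h4
      have := cert.even _ hw.1 (even_iff_two_dvd.1 hx2) _ hw.2.1 ⟨h4, hw.2.2⟩ (qsign Y x)
        (by simp [qsign])
      rw [if_neg h0, if_neg h1]
      rcases rind_eq_or Y D x with hr | hr <;> rw [hr]
      · linarith [this.1]
      · linarith [this.2]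
  have hs := Finset.sum_le_sum hev
  simp only [Finset.sum_add_distrib, ← Finset.mul_sum, Finset.sum_const, nsmul_eq_mul,
    Finset.sum_ite_eq', mem_words, D.zero_mem, hyD, if_true] at hs
  linarith

theorem no_weight_sixty_eight (hC : #(words C) = 1024)
    (hmin : ∀ x ∈ C, x ≠ 0 → 56 ≤ cnt univ x) (heven : ∀ x ∈ C, 2 ∣ cnt univ x)
    (hyC : y ∈ C) (h4 : ∀ x ∈ C, Even (cnt (supp y) x) → 4 ∣ cnt univ x) : cnt univ y ≠ 68 := by
  classical
  intro hy
  let D : Submodule (ZMod 2) (Fin 118 → ZMod 2) := AddSubgroup.toZModSubmodule 2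
    { carrier := {x | x ∈ C ∧ Even (cnt (supp y) x)}
      zero_mem' := ⟨C.zero_mem, by simp⟩
      add_mem' := fun {a b} ha hb => ⟨C.add_mem ha.1 hb.1, by
        have e := cnt_add (supp y) a b
        have e1 := Nat.even_iff.1 ha.2
        have e2 := Nat.even_iff.1 hb.2
        rw [Nat.even_iff]; omega⟩
      neg_mem' := fun {a} ha => by rwa [ZModModule.neg_eq_self a] }
  have hD : ∀ x, x ∈ D ↔ x ∈ C ∧ Even (cnt (supp y) x) := fun x => Iff.rfl
  have hy4 : 4 ∣ cnt univ y := by rw [hy]; decide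
  have hyD : y ∈ D := (hD y).2 ⟨hyC, by rw [cnt_supp_self, hy]; decide⟩
  have hy0 : y ≠ 0 := by rintro rfl; simp at hy
  have hN : #(words D) = 1024 ∨ #(words D) = 512 := by
    obtain ⟨k, hk⟩ := (PD.sign (isSign_cnt (supp y))).sum_words_eq C
    have hDC : words D = {x ∈ words C | Even (cnt (supp y) x)} := by ext x; simp [hD]
    have hcard := Finset.card_filter_add_card_filter_not (s := words C)
      (fun x => Even (cnt (supp y) x))
    rw [Finset.sum_ite, Finset.sum_const, Finset.sum_const, ← hDC, hC] at hk
    rw [← hDC, hC] at hcard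
    simp only [nsmul_eq_mul] at hk
    omega
  obtain ⟨t, h1, h2, h3⟩ := exists_type (supp y) D fun x hx => ((hD x).1 hx).2
  have key := fun {a b c d e p q al be ga de k : ℤ}
    (cert : Cert68 t a b c d e p q al be ga de k) =>
    cert.not_code hC hmin heven hyC hy rfl hD (fun x hx => h4 x ((hD x).1 hx).1 ((hD x).1 hx).2)
      fun f hf => (h2 f hf).1
  have hr : 2 ≤ ∑ x ∈ words D, rind (supp y) D x := by
    have hsub : {0, y} ⊆ words D := by
      intro x hx
      rw [Finset.mem_insert, Finset.mem_singleton] at hx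
      rcases hx with rfl | rfl
      · simp
      · simpa using hyD
    have := Finset.sum_le_sum_of_subset_of_nonneg hsub (f := rind (supp y) D) fun x _ _ => by
      rcases rind_eq_or (supp y) D x with h | h <;> simp [h]
    rw [Finset.sum_pair hy0.symm, rind_supp_self hy4 fun x hx => ((hD x).1 hx).2,
      rind_eq_one.2 fun z _ => by simp [qsign]] at this
    exact this
  replace h3 : (∑ x ∈ words D, rind (supp y) D x * qsign (supp y) x =
        ∑ x ∈ words D, rind (supp y) D x ∧
          (t * ∑ x ∈ words D, qsign (supp y) x = #(words D) ∨
            t * ∑ x ∈ words D, qsign (supp y) x = -(#(words D) : ℤ))) ∨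
        (∑ x ∈ words D, qsign (supp y) x = 0 ∧
          ∑ x ∈ words D, rind (supp y) D x * qsign (supp y) x = 0) := by
    refine h3.imp_left fun h => ⟨Finset.sum_congr rfl fun x hx => ?_, h.2⟩
    rcases rind_eq_or (supp y) D x with h0 | h0
    · simp [h0]
    · simp [h0, h.1 x (mem_words.1 hx) h0]
  generalize ∑ x ∈ words D, rind (supp y) D x = r at *
  generalize ∑ x ∈ words D, qsign (supp y) x = S at *
  generalize ∑ x ∈ words D, rind (supp y) D x * qsign (supp y) x = ρ at *
  clear h2
  have ht : t < 32 := by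
    by_contra h
    have : (32 : ℤ) ≤ t := by exact_mod_cast not_lt.1 h
    have : (32 : ℤ) ^ 2 * 2 ≤ t ^ 2 * r := by gcongr
    omega
  have ht' : t = 1 ∨ t = 2 ∨ t = 4 ∨ t = 8 ∨ t = 16 := by
    rcases hN with hN | hN <;> rw [hN] at h1 <;> interval_cases t <;> omega
  rcases hN with hN | hN <;> rw [hN] at h1 h3 key
  · rcases ht' with rfl | rfl | rfl | rfl | rfl
    · rcases h3 with ⟨rfl, h3 | h3⟩ | ⟨rfl, rfl⟩
      · exact key (by decide +kernel : Cert68 _ 384 34 1 0 0 0 0 36 (-1120) 0 0 (-148)) (by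
          norm_num [base68, twist68]; omega)
      · exact key (by decide +kernel : Cert68 _ 0 0 0 0 0 0 0 1 1 0 (-1) 0) (by
          norm_num [base68, twist68]; omega)
      · exact key (by decide +kernel : Cert68 _ 168 18 1 0 0 12 0 (-276) (-288) (-120) (-48) (-276)) (by
          norm_num [base68, twist68]; omega)
    · rcases h3 with ⟨rfl, h3 | h3⟩ | ⟨rfl, rfl⟩
      · exact key (by decide +kernel : Cert68 _ 173 18 1 0 0 19 0 (-366) (-366) 148 (-72) (-336)) (by
          norm_num [base68, twist68]; omega)
      · exact key (by decide +kernel : Cert68 _ 332 22 1 20 2 36 0 (-1308) 72 432 (-864) (-1164)) (by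
          norm_num [base68, twist68]; omega)
      · exact key (by decide +kernel : Cert68 _ 348 33 2 0 0 36 3 (-678) (-786) (-240) 108 (-786)) (by
          norm_num [base68, twist68]; omega)
    · rcases h3 with ⟨rfl, h3 | h3⟩ | ⟨rfl, rfl⟩
      · exact key (by decide +kernel : Cert68 _ 168 18 1 0 0 24 0 (-396) (-336) 576 (-384) (-276)) (by
          norm_num [base68, twist68]; omega)
      · exact key (by decide +kernel : Cert68 _ 1938 134 5 100 10 458 24 (-8528) (-1628) 6384 (-7136) (-7708)) (by
          norm_num [base68, twist68]; omega)
      · exact key (by decide +kernel : Cert68 _ 168 18 1 0 0 24 0 (-396) (-336) 576 (-384) (-276)) (by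
          norm_num [base68, twist68]; omega)
    · rcases h3 with ⟨rfl, h3 | h3⟩ | ⟨rfl, rfl⟩
      · exact key (by decide +kernel : Cert68 _ 168 18 1 0 0 24 0 (-396) (-336) 1536 (-1152) (-276)) (by
          norm_num [base68, twist68]; omega)
      · exact key (by decide +kernel : Cert68 _ 460 44 2 10 1 72 0 (-1440) (-720) 5760 (-4608) (-1160)) (by
          norm_num [base68, twist68]; omega)
      · exact key (by decide +kernel : Cert68 _ 168 18 1 0 0 24 0 (-396) (-336) 1536 (-1152) (-276)) (by
          norm_num [base68, twist68]; omega)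
    · rcases h3 with ⟨rfl, h3 | h3⟩ | ⟨rfl, rfl⟩
      · exact key (by decide +kernel : Cert68 _ 168 18 1 0 0 24 0 (-396) (-336) 3456 (-2688) (-276)) (by
          norm_num [base68, twist68]; omega)
      · exact key (by decide +kernel : Cert68 _ 460 44 2 10 1 72 0 (-1440) (-720) 12032 (-9728) (-1160)) (by
          norm_num [base68, twist68]; omega)
      · exact key (by decide +kernel : Cert68 _ 168 18 1 0 0 24 0 (-396) (-336) 3456 (-2688) (-276)) (by
          norm_num [base68, twist68]; omega)
  · rcases ht' with rfl | rfl | rfl | rfl | rfl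
    · rcases h3 with ⟨rfl, h3 | h3⟩ | ⟨rfl, rfl⟩
      · exact key (by decide +kernel : Cert68 _ 309 31 1 0 0 18 0 (-42) (-682) (-180) (-72) (-286)) (by
          norm_num [base68, twist68]; omega)
      · exact key (by decide +kernel : Cert68 _ 0 0 0 0 0 0 0 1 1 0 (-1) 0) (by
          norm_num [base68, twist68]; omega)
      · exact key (by decide +kernel : Cert68 _ 164 16 1 0 0 14 0 (-308) (-312) (-52) 32 (-416)) (by
          norm_num [base68, twist68]; omega)
    · rcases h3 with ⟨rfl, h3 | h3⟩ | ⟨rfl, rfl⟩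
      · exact key (by decide +kernel : Cert68 _ 180 18 1 0 0 12 0 (-324) (-408) (-48) 96 (-420)) (by
          norm_num [base68, twist68]; omega)
      · exact key (by decide +kernel : Cert68 _ 404 28 1 20 2 108 6 (-1728) (-348) 720 (-840) (-1656)) (by
          norm_num [base68, twist68]; omega)
      · exact key (by decide +kernel : Cert68 _ 180 18 1 0 0 12 0 (-324) (-408) (-48) 96 (-420)) (by
          norm_num [base68, twist68]; omega)
    · rcases h3 with ⟨rfl, h3 | h3⟩ | ⟨rfl, rfl⟩
      · exact key (by decide +kernel : Cert68 _ 164 16 1 0 0 20 0 (-344) (-312) 416 (-256) (-416)) (by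
          norm_num [base68, twist68]; omega)
      · exact key (by decide +kernel : Cert68 _ 164 16 1 0 0 28 0 (-360) (-280) 672 (-448) (-416)) (by
          norm_num [base68, twist68]; omega)
      · exact key (by decide +kernel : Cert68 _ 164 16 1 0 0 20 0 (-344) (-312) 416 (-256) (-416)) (by
          norm_num [base68, twist68]; omega)
    · rcases h3 with ⟨rfl, h3 | h3⟩ | ⟨rfl, rfl⟩
      · exact key (by decide +kernel : Cert68 _ 164 16 1 0 0 20 0 (-344) (-312) 928 (-608) (-416)) (by
          norm_num [base68, twist68]; omega)
      · exact key (by decide +kernel : Cert68 _ 164 16 1 0 0 28 0 (-360) (-280) 1664 (-1216) (-416)) (by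
          norm_num [base68, twist68]; omega)
      · exact key (by decide +kernel : Cert68 _ 164 16 1 0 0 20 0 (-344) (-312) 928 (-608) (-416)) (by
          norm_num [base68, twist68]; omega)
    · rcases h3 with ⟨rfl, h3 | h3⟩ | ⟨rfl, rfl⟩
      · exact key (by decide +kernel : Cert68 _ 164 16 1 0 0 20 0 (-344) (-312) 2528 (-1888) (-416)) (by
          norm_num [base68, twist68]; omega)
      · exact key (by decide +kernel : Cert68 _ 164 16 1 0 0 20 0 (-344) (-312) 2528 (-1888) (-416)) (by
          norm_num [base68, twist68]; omega)
      · exact key (by decide +kernel : Cert68 _ 164 16 1 0 0 20 0 (-344) (-312) 2528 (-1888) (-416)) (by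
          norm_num [base68, twist68]; omega)

end
end WeightSixtyEight

section DoublyEven

theorem IsSign.sum_words_eq {ι : Type*} [Finite ι] {χ : (ι → ZMod 2) → ℤ} (h : IsSign χ)
    (D : Submodule (ZMod 2) (ι → ZMod 2)) :
    (∀ x ∈ D, χ x = 1) ∨ ∑ x ∈ words D, χ x = 0 := by
  have := Fintype.ofFinite D
  rw [sum_words]
  exact (h.comp D.subtype.toAddMonoidHom).sum_eq.imp_left fun h x hx => h ⟨x, hx⟩

theorem sum_words_le {ι : Type*} [Finite ι] {C : Submodule (ZMod 2) (ι → ZMod 2)}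
    {F B : (ι → ZMod 2) → ℤ} (h : ∀ x ∈ C, x ≠ 0 → F x ≤ B x) :
    ∑ x ∈ words C, F x ≤ ∑ x ∈ words C, B x + (F 0 - B 0) := by
  classical
  have h0 : (0 : ι → ZMod 2) ∈ words C := by simp
  rw [← Finset.add_sum_erase _ F h0, ← Finset.add_sum_erase _ B h0]
  have := Finset.sum_le_sum (s := (words C).erase 0) (f := F) (g := B) fun x hx => by
    rw [Finset.mem_erase, mem_words] at hx
    exact h x hx.2 hx.1
  linarith

theorem sum_words_add {ι : Type*} [Finite ι] {C : Submodule (ZMod 2) (ι → ZMod 2)}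
    {y : ι → ZMod 2} (hy : y ∈ C) (F : (ι → ZMod 2) → ℤ) :
    ∑ x ∈ words C, F (x + y) = ∑ x ∈ words C, F x := by
  have := Fintype.ofFinite C
  rw [sum_words, sum_words]
  exact Equiv.sum_comp (Equiv.addRight (⟨y, hy⟩ : C)) fun x => F x

/-- A combination of the first three power moments of the coordinate sum of a word of length 118
and weight `w`. -/
def poly118 (a b c w : ℤ) : ℤ :=
  a * (118 - 2 * w) + b * ((118 - 2 * w) ^ 2 - 118) +
    c * ((118 - 2 * w) ^ 3 - 352 * (118 - 2 * w))

theorem pd_poly118 {a b c : ℤ} (ha : 0 ≤ a) (hb : 0 ≤ b) (hc : 0 ≤ c) :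
    PD fun x : Fin 118 → ZMod 2 => poly118 a b c (cnt univ x) := by
  obtain ⟨h1, h2, h3⟩ := pd_cs_all (univ : Finset (Fin 118))
  convert ((h1.smul ha).add (h2.smul hb)).add (h3.smul hc) using 2 with x
  simp only [poly118, cs, Finset.card_univ, Fintype.card_fin]
  push_cast
  ring

variable {C : Submodule (ZMod 2) (Fin 118 → ZMod 2)} {y : Fin 118 → ZMod 2}

theorem cnt_univ_lt (x : Fin 118 → ZMod 2) : cnt univ x < 119 := by
  have := cnt_le univ x
  rw [Finset.card_univ, Fintype.card_fin] at this
  omega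

theorem sum_qsign_gt (hC : #(words C) = 1024)
    (hmin : ∀ x ∈ C, x ≠ 0 → 56 ≤ cnt univ x) (heven : ∀ x ∈ C, 2 ∣ cnt univ x) :
    128 < ∑ x ∈ words C, qsign univ x := by
  have key : ∀ w : ℕ, w < 119 → 56 ≤ w → 2 ∣ w →
      poly118 588 34 1 w ≤ -2276 + 1120 * (if 4 ∣ w then 1 else -1) := by decide +kernel
  have h1 := (pd_poly118 (a := 588) (b := 34) (c := 1) (by norm_num) (by norm_num)
    (by norm_num)).sum_words_nonneg C
  have h2 := sum_words_le (C := C) (F := fun x => poly118 588 34 1 (cnt univ x))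
    (B := fun x => -2276 + 1120 * qsign univ x)
    fun x hx h0 => key _ (cnt_univ_lt x) (hmin x hx h0) (heven x hx)
  simp only [Finset.sum_add_distrib, ← Finset.mul_sum, Finset.sum_const, nsmul_eq_mul, hC,
    cnt_zero, qsign, dvd_zero, if_true, poly118] at h1 h2 ⊢
  norm_num at h1 h2
  linarith

/-- If the Gauss sum of the weights is half the number of words then the words orthogonal to a
word of weight 68 outside the radical have weight divisible by four. -/
theorem four_dvd_of_sum_qsign (hC : #(words C) = 1024) (heven : ∀ x ∈ C, 2 ∣ cnt univ x)
    (hS : ∑ x ∈ words C, qsign univ x = 512) (hyC : y ∈ C) (hy : cnt univ y = 68)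
    (hyR : rind univ C y ≠ 1) : ∀ x ∈ C, Even (cnt (supp y) x) → 4 ∣ cnt univ x := by
  obtain ⟨χ, hχ⟩ : ∃ χ : (Fin 118 → ZMod 2) → ℤ,
    χ = fun x => if Even (cnt (supp y) x) then 1 else -1 := ⟨_, rfl⟩
  have hχs : IsSign χ := hχ ▸ isSign_cnt _
  have hadd : ∀ x ∈ C, qsign univ (x + y) = qsign univ x * χ x := fun x hx => by
    have e := cnt_add_supp x y
    have e1 := heven x hx
    simp only [qsign, hχ, Nat.even_iff]
    by_cases h1 : 4 ∣ cnt univ x <;> by_cases h2 : 4 ∣ cnt univ (x + y) <;>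
      simp only [h1, h2, if_true, if_false] <;> split_ifs <;> first | rfl | omega
  have h0 : ∑ x ∈ words C, χ x = 0 := by
    refine (hχs.sum_words_eq C).resolve_left fun h => hyR (rind_eq_one.2 fun z hz => ?_)
    rw [add_comm, hadd z hz, h z hz]
    simp [qsign, hy]
  have h1 : ∑ x ∈ words C, qsign univ x * χ x = 512 := by
    rw [← hS, ← sum_words_add hyC (qsign univ)]
    exact Finset.sum_congr rfl fun x hx => (hadd x (mem_words.1 hx)).symm
  have h2 : ∑ x ∈ words C, (1 + χ x) * (1 - qsign univ x) = 0 := by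
    have : ∀ x, (1 + χ x) * (1 - qsign univ x) =
      1 + χ x - qsign univ x - qsign univ x * χ x := fun x => by ring
    simp only [this, Finset.sum_add_distrib, Finset.sum_sub_distrib, h0, h1, hS,
      Finset.sum_const, hC]
    norm_num
  intro x hx hxe
  rw [Finset.sum_eq_zero_iff_of_nonneg] at h2
  · have := h2 x (mem_words.2 hx)
    by_contra h4
    simp [hχ, hxe, qsign, h4] at this
  · intro x _
    rcases qsign_eq_or univ x with h | h <;> rw [h, hχ] <;> dsimp only <;> split_ifs <;> norm_num

theorem four_dvd (hC : #(words C) = 1024)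
    (hmin : ∀ x ∈ C, x ≠ 0 → 56 ≤ cnt univ x) (heven : ∀ x ∈ C, 2 ∣ cnt univ x) :
    ∀ x ∈ C, 4 ∣ cnt univ x := by
  have hS := sum_qsign_gt hC hmin heven
  obtain ⟨t, h1, h2, h3⟩ := exists_type univ C fun x hx => even_iff_two_dvd.2 (heven x hx)
  rw [hC] at h1 h3
  obtain ⟨h4, h3⟩ : (∀ x ∈ C, rind univ C x = 1 → qsign univ x = 1) ∧
      t * ∑ x ∈ words C, qsign univ x = 1024 := by
    rcases h3 with ⟨h4, h3 | h3⟩ | h3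
    · exact ⟨h4, h3⟩
    · have : 0 ≤ t * ∑ x ∈ words C, qsign univ x := by positivity
      rw [h3] at this
      norm_num at this
    · omega
  have ht8 : t < 8 := by
    by_contra h
    have : (8 : ℤ) ≤ t := by exact_mod_cast not_lt.1 h
    have : (8 : ℤ) * 129 ≤ t * ∑ x ∈ words C, qsign univ x := by gcongr; omega
    omega
  have ht : t = 1 ∨ t = 2 ∨ t = 4 := by interval_cases t <;> omega
  have hQR : ∑ x ∈ words C, rind univ C x * qsign univ x = ∑ x ∈ words C, rind univ C x :=
    Finset.sum_congr rfl fun x hx => by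
      rcases rind_eq_or univ C x with h0 | h0
      · simp [h0]
      · simp [h0, h4 x (mem_words.1 hx) h0]
  have hR0 : rind univ C 0 = 1 := rind_eq_one.2 fun z _ => by simp [qsign]
  rcases ht with rfl | rfl | rfl
  · have h5 : ∑ x ∈ words C, (1 - qsign univ x) = 0 := by
      rw [Finset.sum_sub_distrib, Finset.sum_const, hC]
      norm_num at h3 ⊢
      linarith
    intro x hx
    rw [Finset.sum_eq_zero_iff_of_nonneg] at h5
    · have := h5 x (mem_words.2 hx)
      by_contra h6
      simp [qsign, h6] at this
    · intro x _
      rcases qsign_eq_or univ x with h | h <;> rw [h] <;> norm_num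
  · exfalso
    have hS : ∑ x ∈ words C, qsign univ x = 512 := by omega
    have hr : ∑ x ∈ words C, rind univ C x = 256 := by omega
    obtain ⟨y, hyC, hy, hyR⟩ : ∃ y ∈ C, cnt univ y = 68 ∧ rind univ C y ≠ 1 := by
      by_contra! hno
      have key : ∀ w : ℕ, w < 119 → 56 ≤ w → 2 ∣ w →
          ∀ Q ∈ [if 4 ∣ w then (1 : ℤ) else -1],
          (w ≠ 68 → poly118 492 32 1 w + Q * poly118 0 1 0 w - Q * poly118 96 3 0 w ≤
            -2688 + 708 * Q) ∧
          poly118 492 32 1 w + 3 * (Q * poly118 0 1 0 w) + Q * poly118 96 3 0 w ≤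
            -2688 + 708 * Q + 1280 - 784 * Q := by decide +kernel
      have g1 := (pd_poly118 (a := 492) (b := 32) (c := 1) (by norm_num) (by norm_num)
        (by norm_num)).sum_words_nonneg C
      have g2 := (h2 _ (pd_poly118 (a := 0) (b := 1) (c := 0) (by norm_num) (by norm_num)
        (by norm_num))).1
      have g3 := (h2 _ (pd_poly118 (a := 96) (b := 3) (c := 0) (by norm_num) (by norm_num)
        (by norm_num))).2
      have g4 := sum_words_le (C := C) (F := fun x => poly118 492 32 1 (cnt univ x) +
          qsign univ x * ((2 : ℕ) * rind univ C x + 1) * poly118 0 1 0 (cnt univ x) +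
          qsign univ x * ((2 : ℕ) * rind univ C x - 1) * poly118 96 3 0 (cnt univ x))
        (B := fun x => -2688 + 708 * qsign univ x + 1280 * rind univ C x -
          784 * (rind univ C x * qsign univ x)) fun x hx h0 => by
        have := key _ (cnt_univ_lt x) (hmin x hx h0) (heven x hx) (qsign univ x) (by simp [qsign])
        rcases rind_eq_or univ C x with hr | hr <;> rw [hr] <;> push_cast
        · have := this.1 fun h => by simp [hno x hx h] at hr
          linarith
        · linarith [this.2]
      simp only [Finset.sum_add_distrib, Finset.sum_sub_distrib, ← Finset.mul_sum,
        Finset.sum_const, nsmul_eq_mul, hC, hS, hr, hQR, hR0] at g4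
      rw [show qsign univ (0 : Fin 118 → ZMod 2) = 1 by simp [qsign], cnt_zero] at g4
      norm_num [poly118] at g1 g2 g3 g4
      linarith
    exact no_weight_sixty_eight hC hmin heven hyC
      (four_dvd_of_sum_qsign hC heven hS hyC hy hyR) hy
  · exfalso
    have hS : ∑ x ∈ words C, qsign univ x = 256 := by omega
    have hr : ∑ x ∈ words C, rind univ C x = 64 := by omega
    have key : ∀ w : ℕ, w < 119 → 56 ≤ w → 2 ∣ w →
        ∀ Q ∈ [if 4 ∣ w then (1 : ℤ) else -1],
        poly118 612 38 1 w - Q * poly118 56 0 0 w ≤ -2684 + 1008 * Q ∧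
        poly118 612 38 1 w + 3 * (Q * poly118 56 0 0 w) ≤
          -2684 + 1008 * Q + 3136 - 1792 * Q := by decide +kernel
    have g1 := (pd_poly118 (a := 612) (b := 38) (c := 1) (by norm_num) (by norm_num)
      (by norm_num)).sum_words_nonneg C
    have g3 := (h2 _ (pd_poly118 (a := 56) (b := 0) (c := 0) (by norm_num) (by norm_num)
      (by norm_num))).2
    have g4 := sum_words_le (C := C) (F := fun x => poly118 612 38 1 (cnt univ x) +
        qsign univ x * ((4 : ℕ) * rind univ C x - 1) * poly118 56 0 0 (cnt univ x))
      (B := fun x => -2684 + 1008 * qsign univ x + 3136 * rind univ C x -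
        1792 * (rind univ C x * qsign univ x)) fun x hx h0 => by
      have := key _ (cnt_univ_lt x) (hmin x hx h0) (heven x hx) (qsign univ x) (by simp [qsign])
      rcases rind_eq_or univ C x with hr | hr <;> rw [hr] <;> push_cast
      · linarith [this.1]
      · linarith [this.2]
    simp only [Finset.sum_add_distrib, Finset.sum_sub_distrib, ← Finset.mul_sum,
      Finset.sum_const, nsmul_eq_mul, hC, hS, hr, hQR, hR0] at g4
    rw [show qsign univ (0 : Fin 118 → ZMod 2) = 1 by simp [qsign], cnt_zero] at g4
    norm_num [poly118] at g1 g3 g4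
    linarith

end DoublyEven

section EightDivisible

theorem exists_pd_half {ι : Type*} (K : Finset ι) :
    ∃ g : (ι → ZMod 2) → ℤ, PD g ∧ ∀ c, cs K c ^ 2 - #K = 2 * g c := by
  classical
  induction K using Finset.induction_on with
  | empty => exact ⟨_, .zero, fun c => by simp [cs, cnt]⟩
  | insert k K hk ih =>
    obtain ⟨g, hg, e⟩ := ih
    have hs := isSign_coord k
    refine ⟨_, hg.add ((pd_cs_all K).1.sign_mul hs), fun c => ?_⟩
    rw [cs_insert hk c, Finset.card_insert_of_notMem hk]
    push_cast
    linear_combination e c + hs.mul_self c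

variable {C : Submodule (ZMod 2) (Fin 118 → ZMod 2)}

theorem card_filter_four_lt (hC : #(words C) = 1024)
    (hmin : ∀ x ∈ C, x ≠ 0 → 56 ≤ cnt univ x) (h4 : ∀ x ∈ C, 4 ∣ cnt univ x)
    (h68 : ∀ x ∈ C, cnt univ x ≠ 68) :
    ∑ x ∈ words C, (if 8 ∣ cnt univ x then (0 : ℤ) else 1) < 128 := by
  have key : ∀ w : ℕ, w < 119 → 56 ≤ w → 4 ∣ w → w ≠ 68 →
      poly118 396 30 1 w ≤ -1980 - 1536 * (if 8 ∣ w then 0 else 1) := by decide +kernel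
  have h1 := (pd_poly118 (a := 396) (b := 30) (c := 1) (by norm_num) (by norm_num)
    (by norm_num)).sum_words_nonneg C
  have h2 := sum_words_le (C := C) (F := fun x => poly118 396 30 1 (cnt univ x))
    (B := fun x => -1980 - 1536 * (if 8 ∣ cnt univ x then 0 else 1))
    fun x hx h0 => key _ (cnt_univ_lt x) (hmin x hx h0) (h4 x hx) (h68 x hx)
  simp only [Finset.sum_sub_distrib, ← Finset.mul_sum, Finset.sum_const, nsmul_eq_mul, hC,
    cnt_zero, dvd_zero, if_true, poly118] at h1 h2
  norm_num at h1 h2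
  linarith

theorem sum_qsign_supp_ge (hC : #(words C) = 1024) (K : Finset (Fin 118))
    (hK : ∀ x ∈ C, Even (cnt K x)) : -512 ≤ ∑ x ∈ words C, qsign K x := by
  obtain ⟨t, -, -, h3⟩ := exists_type K C hK
  rw [hC] at h3
  by_contra! hlt
  have h5 : t * ∑ x ∈ words C, qsign K x = -1024 := by
    rcases h3 with ⟨-, h3 | h3⟩ | h3
    · have : t * ∑ x ∈ words C, qsign K x ≤ 0 :=
        mul_nonpos_of_nonneg_of_nonpos (by positivity) (by omega)
      rw [h3] at this
      norm_num at this
    · exact h3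
    · omega
  have ht : t < 2 := by
    by_contra h
    have : (2 : ℤ) ≤ t := by exact_mod_cast not_lt.1 h
    nlinarith
  interval_cases t
  · simp at h5
  · have h6 : ∑ x ∈ words C, (1 + qsign K x) = 0 := by
      rw [Finset.sum_add_distrib, Finset.sum_const, hC]
      norm_num at h5 ⊢
      linarith
    rw [Finset.sum_eq_zero_iff_of_nonneg] at h6
    · have := h6 0 (by simp)
      simp [qsign] at this
    · intro x _
      rcases qsign_eq_or K x with h | h <;> rw [h] <;> norm_num

theorem eight_dvd (hC : #(words C) = 1024)
    (hmin : ∀ x ∈ C, x ≠ 0 → 56 ≤ cnt univ x) (heven : ∀ x ∈ C, 2 ∣ cnt univ x) :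
    ∀ x ∈ C, 8 ∣ cnt univ x := by
  have h4 := four_dvd hC hmin heven
  have hT := card_filter_four_lt hC hmin h4 fun x hx =>
    no_weight_sixty_eight hC hmin heven hx fun z hz _ => h4 z hz
  intro y hy
  by_contra hy8
  have hy4 := h4 y hy
  have hS := sum_qsign_supp_ge hC (supp y) fun x hx => by
    have e := cnt_add_supp x y
    have e1 := h4 x hx
    have e2 := h4 _ (C.add_mem hx hy)
    rw [Nat.even_iff]; omega
  have hle := Finset.sum_le_sum (s := words C) (f := fun x => 1 + qsign (supp y) x)
    (g := fun x => 2 * ((if 8 ∣ cnt univ x then 0 else 1) +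
      (if 8 ∣ cnt univ (x + y) then 0 else 1))) fun x hx => by
    rw [mem_words] at hx
    have e := cnt_add_supp x y
    have e1 := h4 x hx
    simp only [qsign]
    by_cases h1 : 8 ∣ cnt univ x <;> by_cases h2 : 8 ∣ cnt univ (x + y) <;>
      simp only [h1, h2, if_true, if_false] <;> split_ifs <;> omega
  rw [← Finset.mul_sum, Finset.sum_add_distrib, Finset.sum_add_distrib,
    sum_words_add hy fun x => if 8 ∣ cnt univ x then (0 : ℤ) else 1, Finset.sum_const, hC] at hle
  norm_num at hle
  linarith

/-- The number of words of a given weight. -/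
noncomputable def wcount (C : Submodule (ZMod 2) (Fin 118 → ZMod 2)) (w : ℕ) : ℕ :=
  #{x ∈ words C | cnt univ x = w}

theorem wcount_eq_zero {w : ℕ} (h : ∀ x ∈ C, cnt univ x ≠ w) : wcount C w = 0 := by
  rw [wcount, Finset.card_eq_zero, Finset.filter_eq_empty_iff]
  exact fun x hx => h x (mem_words.1 hx)

theorem wcount_zero : wcount C 0 = 1 := by
  rw [wcount, Finset.card_eq_one]
  refine ⟨0, ?_⟩
  ext x
  rw [Finset.mem_filter, mem_words, Finset.mem_singleton]
  exact ⟨fun h => cnt_univ_eq_zero h.2, by rintro rfl; simp⟩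

theorem sum_words_eq_sum_wcount {t : Finset ℕ} (h : ∀ x ∈ C, cnt univ x ∈ t) (f : ℕ → ℤ) :
    ∑ x ∈ words C, f (cnt univ x) = ∑ w ∈ t, wcount C w * f w := by
  rw [← Finset.sum_fiberwise_of_maps_to (g := fun x => cnt univ x) (t := t)
    fun x hx => h x (mem_words.1 hx)]
  refine Finset.sum_congr rfl fun w _ => ?_
  rw [Finset.sum_congr rfl (g := fun _ => f w) fun x hx => by rw [(Finset.mem_filter.1 hx).2],
    Finset.sum_const, nsmul_eq_mul, wcount]

theorem cnt_univ_mem (hmin : ∀ x ∈ C, x ≠ 0 → 56 ≤ cnt univ x) (h8 : ∀ x ∈ C, 8 ∣ cnt univ x) :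
    ∀ x ∈ C, cnt univ x ∈ ({0, 56, 64, 72, 80, 88, 96, 104, 112} : Finset ℕ) := fun x hx => by
  have h1 := cnt_univ_lt x
  have h2 := h8 x hx
  by_cases h0 : x = 0
  · simp [h0]
  · have h3 := hmin x hx h0
    simp only [Finset.mem_insert, Finset.mem_singleton]
    omega

theorem exists_wcount (hC : #(words C) = 1024)
    (hmin : ∀ x ∈ C, x ≠ 0 → 56 ≤ cnt univ x) (h8 : ∀ x ∈ C, 8 ∣ cnt univ x) :
    wcount C 80 ≤ 1 ∧ wcount C 56 + wcount C 80 = 720 ∧ wcount C 64 = 215 + 3 * wcount C 80 ∧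
      wcount C 72 + 3 * wcount C 80 = 88 ∧ wcount C 88 = 0 ∧ wcount C 96 = 0 ∧
      wcount C 104 = 0 ∧ wcount C 112 = 0 := by
  have hs := fun f => sum_words_eq_sum_wcount (cnt_univ_mem hmin h8) f
  have e0 := hs fun _ => 1
  obtain ⟨a, ha⟩ := (pd_cs_all (univ : Finset (Fin 118))).1.sum_words_eq C
  have e1 := hs fun w => 118 - 2 * w
  obtain ⟨g, hg, hge⟩ := exists_pd_half (univ : Finset (Fin 118))
  obtain ⟨b, hb⟩ := hg.sum_words_eq C
  have e2 := hs fun w => (118 - 2 * w) ^ 2 - 118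
  have h3 := (pd_poly118 (a := 0) (b := 0) (c := 1) (by norm_num) (by norm_num)
    (by norm_num)).sum_words_nonneg C
  have e3 := hs fun w => poly118 0 0 1 w
  have e1' : ∑ x ∈ words C, (118 - 2 * (cnt univ x : ℤ)) = 1024 * (a : ℤ) := by
    rw [hC] at ha
    exact ha
  have e2' : ∑ x ∈ words C, ((118 - 2 * (cnt univ x : ℤ)) ^ 2 - 118) = 2048 * (b : ℤ) := by
    have : ∀ x, (118 - 2 * (cnt univ x : ℤ)) ^ 2 - 118 = 2 * g x := fun x => hge x
    simp only [this, ← Finset.mul_sum, hb, hC]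
    push_cast; ring
  rw [Finset.sum_const, hC] at e0
  rw [e1'] at e1
  rw [e2'] at e2
  rw [e3] at h3
  have n0 := wcount_zero (C := C)
  simp only [Finset.mem_insert, Finset.mem_singleton, not_false_eq_true, Finset.sum_insert,
    Finset.sum_singleton, Nat.reduceEqDiff, or_self, OfNat.zero_ne_ofNat, n0, poly118]
    at e0 e1 e2 h3
  generalize wcount C 56 = n56 at *
  generalize wcount C 64 = n64 at *
  generalize wcount C 72 = n72 at *
  generalize wcount C 80 = n80 at *
  generalize wcount C 88 = n88 at *
  generalize wcount C 96 = n96 at *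
  generalize wcount C 104 = n104 at *
  generalize wcount C 112 = n112 at *
  norm_num at e0 e1 e2 h3
  clear hs ha hb e1' e2' e3 hg hge n0 hC hmin h8
  have ha : a = 0 := by
    by_contra h
    have : 1 ≤ a := Nat.pos_of_ne_zero h
    zify at *
    linarith
  subst ha
  have hb : b = 0 := by
    by_contra h
    have : 1 ≤ b := Nat.pos_of_ne_zero h
    zify at *
    linarith
  subst hb
  zify at *
  have h112 : (n112 : ℤ) < 1 := by linarith
  have h104 : (n104 : ℤ) < 1 := by linarith
  have h96 : (n96 : ℤ) < 1 := by linarith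
  have h88 : (n88 : ℤ) < 1 := by linarith
  have h80 : (n80 : ℤ) < 2 := by linarith
  omega

end EightDivisible

end EvenCode

/-- Every even binary linear `[118, 10, ≥56]` code has one of the following two
weight distributions (`A_i` counting codewords of Hamming weight `i`): either
`A_0 = 1`, `A_56 = 719`, `A_64 = 218`, `A_72 = 85`, `A_80 = 1` and `A_i = 0`
otherwise; or `A_0 = 1`, `A_56 = 720`, `A_64 = 215`, `A_72 = 88` and `A_i = 0`
otherwise. -/
theorem even_code_118_10_56_weight_distribution
    (C : Submodule (ZMod 2) (Fin 118 → ZMod 2))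
    (hdim : Module.finrank (ZMod 2) C = 10)
    (hmin : ∀ c ∈ C, c ≠ 0 → 56 ≤ hammingNorm c)
    (heven : ∀ c ∈ C, 2 ∣ hammingNorm c) :
    (({c : Fin 118 → ZMod 2 | c ∈ C ∧ hammingNorm c = 0}).ncard = 1 ∧
     ({c : Fin 118 → ZMod 2 | c ∈ C ∧ hammingNorm c = 56}).ncard = 719 ∧
     ({c : Fin 118 → ZMod 2 | c ∈ C ∧ hammingNorm c = 64}).ncard = 218 ∧
     ({c : Fin 118 → ZMod 2 | c ∈ C ∧ hammingNorm c = 72}).ncard = 85 ∧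
     ({c : Fin 118 → ZMod 2 | c ∈ C ∧ hammingNorm c = 80}).ncard = 1 ∧
     (∀ i : ℕ, i ∉ ({0, 56, 64, 72, 80} : Set ℕ) →
       ({c : Fin 118 → ZMod 2 | c ∈ C ∧ hammingNorm c = i}).ncard = 0)) ∨
    (({c : Fin 118 → ZMod 2 | c ∈ C ∧ hammingNorm c = 0}).ncard = 1 ∧
     ({c : Fin 118 → ZMod 2 | c ∈ C ∧ hammingNorm c = 56}).ncard = 720 ∧
     ({c : Fin 118 → ZMod 2 | c ∈ C ∧ hammingNorm c = 64}).ncard = 215 ∧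
     ({c : Fin 118 → ZMod 2 | c ∈ C ∧ hammingNorm c = 72}).ncard = 88 ∧
     (∀ i : ℕ, i ∉ ({0, 56, 64, 72} : Set ℕ) →
       ({c : Fin 118 → ZMod 2 | c ∈ C ∧ hammingNorm c = i}).ncard = 0)) := by
  have hcnt : ∀ c : Fin 118 → ZMod 2, hammingNorm c = EvenCode.cnt Finset.univ c := fun _ => rfl
  have hC : (EvenCode.words C).card = 1024 := by
    have := Fintype.ofFinite C
    rw [EvenCode.card_words, Module.card_eq_pow_finrank (K := ZMod 2), hdim, ZMod.card]
    norm_num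
  have hncard : ∀ i, ({c : Fin 118 → ZMod 2 | c ∈ C ∧ hammingNorm c = i}).ncard = EvenCode.wcount C i :=
    fun i => by
      rw [EvenCode.wcount, ← Set.ncard_coe_finset]
      congr 1
      ext c
      simp [hcnt]
  simp only [hcnt] at hmin heven
  have h8 := EvenCode.eight_dvd hC hmin heven
  obtain ⟨h80, h56, h64, h72, h88, h96, h104, h112⟩ := EvenCode.exists_wcount hC hmin h8
  have h0 := EvenCode.wcount_zero (C := C)
  have hz : ∀ i, i ∉ ({0, 56, 64, 72, 80} : Set ℕ) → EvenCode.wcount C i = 0 := fun i hi => by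
    by_contra h
    have hex : ∃ x ∈ C, EvenCode.cnt Finset.univ x = i := by
      by_contra! hne
      exact h (EvenCode.wcount_eq_zero hne)
    obtain ⟨x, hx, rfl⟩ := hex
    have := EvenCode.cnt_univ_mem hmin h8 x hx
    simp only [Finset.mem_insert, Finset.mem_singleton, Set.mem_insert_iff,
      Set.mem_singleton_iff] at this hi
    generalize EvenCode.cnt Finset.univ x = i at *
    rcases this with rfl | rfl | rfl | rfl | rfl | rfl | rfl | rfl | rfl <;> simp_all
  simp only [hncard]
  rcases Nat.le_one_iff_eq_zero_or_eq_one.1 h80 with h | h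
  · refine .inr ⟨h0, by omega, by omega, by omega, fun i hi => ?_⟩
    by_cases hi' : i = 80
    · rw [hi', h]
    · exact hz i (by simp_all)
  · exact .inl ⟨h0, by omega, by omega, by omega, h, hz⟩
end

section
/- Every binary linear code of length 46 and dimension 9 in which every nonzero codeword has Hamming weight at least 20 contains no codeword of Hamming weight 22 and no codeword of Hamming weight 26. -/
open Finset

/-- The nontrivial character of `ZMod 2`, with values in `ℤ`. -/
def binarySign (x : ZMod 2) : ℤ := if x = 0 then 1 else -1

theorem binarySign_add (x y : ZMod 2) : binarySign (x + y) = binarySign x * binarySign y := by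
  revert x y; decide

theorem binarySign_mul_self (x : ZMod 2) : binarySign x * binarySign x = 1 := by
  revert x; decide

theorem sum_prod_binarySign_nonneg {ι M : Type*} [AddCommGroup M] [Fintype M]
    (φ : M →+ ι → ZMod 2) (u : Finset ι) :
    0 ≤ ∑ x, ∏ t ∈ u, binarySign (φ x t) := by
  by_cases h : ∀ x, ∏ t ∈ u, binarySign (φ x t) = 1
  · simp [h]
  · push Not at h
    obtain ⟨y, hy⟩ := h
    have hsq : (∏ t ∈ u, binarySign (φ y t)) * ∏ t ∈ u, binarySign (φ y t) = 1 := by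
      rw [← prod_mul_distrib]
      exact prod_eq_one fun t _ => binarySign_mul_self _
    have hshift : ∑ x, ∏ t ∈ u, binarySign (φ x t) =
        (∑ x, ∏ t ∈ u, binarySign (φ x t)) * ∏ t ∈ u, binarySign (φ y t) := by
      rw [sum_mul, ← Equiv.sum_comp (Equiv.addRight y)]
      refine sum_congr rfl fun x _ => ?_
      rw [← prod_mul_distrib]
      refine prod_congr rfl fun t _ => ?_
      rw [Equiv.coe_addRight, map_add, Pi.add_apply, binarySign_add]
    rcases mul_self_eq_one_iff.mp hsq with h1 | h1
    · exact absurd h1 hy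
    · rw [h1] at hshift
      linarith

/-- The coefficient of `X ^ i` in `(1 + X) ^ p * (1 - X) ^ m`: the value at `m` of the `i`-th
Krawtchouk polynomial of length `p + m`. -/
def krawtchouk (p : ℕ) : ℕ → ℕ → ℤ
  | 0, i => p.choose i
  | _ + 1, 0 => 1
  | m + 1, i + 1 => krawtchouk p m (i + 1) - krawtchouk p m i

theorem krawtchouk_zero_right (p m : ℕ) : krawtchouk p m 0 = 1 := by
  cases m <;> simp [krawtchouk]

theorem krawtchouk_one_right (p m : ℕ) : krawtchouk p m 1 = p - m := by
  induction m with
  | zero => simp [krawtchouk]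
  | succ m ih => rw [krawtchouk, ih, krawtchouk_zero_right]; push_cast; ring

theorem two_mul_krawtchouk_two_right (p m : ℕ) :
    2 * krawtchouk p m 2 = ((p : ℤ) - m) ^ 2 - (p + m) := by
  induction m with
  | zero =>
    induction p with
    | zero => simp [krawtchouk]
    | succ p ih =>
      simp only [krawtchouk, Nat.choose_succ_succ' p 1, Nat.choose_one_right] at ih ⊢
      push_cast at ih ⊢
      linear_combination ih
  | succ m ih =>
    rw [krawtchouk, mul_sub, ih, krawtchouk_one_right]; push_cast; ring

section

variable {ι : Type*} [DecidableEq ι]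

theorem sum_powersetCard_union_prod_binarySign (x : ι → ZMod 2) (P M : Finset ι)
    (hPM : Disjoint P M) (hP : ∀ t ∈ P, x t = 0) (hM : ∀ t ∈ M, x t ≠ 0) (i : ℕ) :
    ∑ u ∈ (P ∪ M).powersetCard i, ∏ t ∈ u, binarySign (x t) = krawtchouk #P #M i := by
  induction M using Finset.induction_on generalizing i with
  | empty =>
    have h : ∀ u ∈ (P ∪ ∅).powersetCard i, ∏ t ∈ u, binarySign (x t) = 1 := by
      intro u hu
      rw [union_empty, mem_powersetCard] at hu
      exact prod_eq_one fun t ht => by simp [binarySign, hP t (hu.1 ht)]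
    rw [sum_congr rfl h]
    simp [krawtchouk]
  | insert a M ha ih =>
    rw [disjoint_insert_right] at hPM
    have ih' := ih hPM.2 fun t ht => hM t (mem_insert_of_mem ht)
    have haU : a ∉ P ∪ M := by simp [ha, hPM.1]
    rw [union_insert, card_insert_of_notMem ha]
    cases i with
    | zero => simp [krawtchouk]
    | succ i =>
      rw [powersetCard_succ_insert haU, sum_union, sum_image, ih', krawtchouk, sub_eq_add_neg,
        ← ih' i, ← sum_neg_distrib]
      · congr 1
        refine sum_congr rfl fun u hu => ?_
        have hau : a ∉ u := fun h => haU ((mem_powersetCard.mp hu).1 h)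
        rw [prod_insert hau, binarySign, if_neg (hM a (mem_insert_self a M)), neg_one_mul]
      · intro u hu v hv huv
        have hau : a ∉ u := fun h => haU ((mem_powersetCard.mp hu).1 h)
        have hav : a ∉ v := fun h => haU ((mem_powersetCard.mp hv).1 h)
        rw [← erase_insert hau, huv, erase_insert hav]
      · rw [disjoint_left]
        intro u hu hu'
        obtain ⟨v, -, rfl⟩ := mem_image.mp hu'
        exact haU ((mem_powersetCard.mp hu).1 (mem_insert_self a v))

theorem sum_powersetCard_prod_binarySign (x : ι → ZMod 2) (A : Finset ι) (i : ℕ) :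
    ∑ u ∈ A.powersetCard i, ∏ t ∈ u, binarySign (x t) =
      krawtchouk #{t ∈ A | x t = 0} #{t ∈ A | x t ≠ 0} i := by
  rw [← sum_powersetCard_union_prod_binarySign x _ _ (disjoint_filter_filter_not A A _)
    (by simp) (by simp), filter_union_filter_not_eq]

variable {M : Type*} [AddCommGroup M] [Fintype M]

/-- A product of Krawtchouk polynomials in the weights on two disjoint sets of coordinates has
nonnegative sum over a linear code. -/
theorem sum_krawtchouk_mul_krawtchouk_nonneg (φ : M →+ ι → ZMod 2) {A B : Finset ι}
    (hAB : Disjoint A B) (i j : ℕ) :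
    0 ≤ ∑ x, krawtchouk #{t ∈ A | φ x t = 0} #{t ∈ A | φ x t ≠ 0} i *
      krawtchouk #{t ∈ B | φ x t = 0} #{t ∈ B | φ x t ≠ 0} j := by
  simp only [← sum_powersetCard_prod_binarySign, sum_mul_sum]
  rw [sum_comm]
  refine sum_nonneg fun u hu => ?_
  rw [sum_comm]
  refine sum_nonneg fun v hv => ?_
  have huv : Disjoint u v :=
    hAB.mono (mem_powersetCard.mp hu).1 (mem_powersetCard.mp hv).1
  simpa only [prod_union huv] using sum_prod_binarySign_nonneg φ (u ∪ v)

end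

/-- Triples `(i, j, y)`, for each weight, of two degrees and the multiplier of the corresponding
product of Krawtchouk polynomials in the linear programming certificate. -/
def multipliers : ℕ → List (ℕ × ℕ × ℕ)
  | 10 => [(0, 1, 1363), (0, 2, 378), (0, 3, 198), (0, 13, 346), (0, 14, 587), (2, 0, 411),
      (2, 1, 37)]
  | 12 => [(0, 1, 43), (0, 13, 317), (2, 1, 31), (2, 13, 203)]
  | 14 => [(0, 1, 383), (0, 2, 88), (0, 9, 159), (0, 10, 543), (0, 11, 1718), (2, 0, 91),
      (2, 1, 53)]
  | 16 => [(0, 1, 374), (2, 0, 276), (2, 1, 70)]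
  | 18 => [(0, 3, 825), (0, 4, 1430), (0, 5, 1515), (0, 6, 1243)]
  | 20 => [(2, 0, 802), (2, 1, 263)]
  | _ => []

/-- The multiplier, for each weight, of the cardinality constraint in the certificate. -/
def cardMultiplier : ℕ → ℤ
  | 10 => 1881
  | 12 => 322
  | 14 => 684
  | 16 => 883
  | 18 => 941
  | 20 => 3168
  | _ => 1

/-- The combination of products of Krawtchouk polynomials with the given multipliers, for a pair
of words `c`, `x` of length 25 with `a` common ones, `b` ones of `x` only and `d` ones of `c`
only. -/
def krawtchoukCombination (l : List (ℕ × ℕ × ℕ)) (a b d : ℕ) : ℤ :=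
  (l.map fun r => (r.2.2 : ℤ) * (krawtchouk d a r.1 * krawtchouk (25 - a - b - d) b r.2.1)).sum

/-- The function on pairs of words of length 25 given by the certificate. -/
def certificate (a b d : ℕ) : ℤ :=
  krawtchoukCombination (multipliers (a + d)) a b d +
    cardMultiplier (a + d) * (1 - if a + b = 0 then 256 else 0)

theorem certificate_rotation_nonpos {a b d : ℕ}
    (hab : a + b = 0 ∨ 10 ≤ a + b ∧ (a + b) % 2 = 0)
    (had : a + d = 0 ∨ 10 ≤ a + d ∧ (a + d) % 2 = 0)
    (hbd : b + d = 0 ∨ 10 ≤ b + d ∧ (b + d) % 2 = 0) (habd : a + b + d ≤ 25) :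
    certificate a b d + certificate b d a + certificate d a b ≤ 0 := by
  have key : ∀ a b d : Fin 25,
      ((a + b : ℕ) = 0 ∨ 10 ≤ (a + b : ℕ) ∧ (a + b : ℕ) % 2 = 0) →
      ((a + d : ℕ) = 0 ∨ 10 ≤ (a + d : ℕ) ∧ (a + d : ℕ) % 2 = 0) →
      ((b + d : ℕ) = 0 ∨ 10 ≤ (b + d : ℕ) ∧ (b + d : ℕ) % 2 = 0) → (a + b + d : ℕ) ≤ 25 →
      certificate a b d + certificate b d a + certificate d a b ≤ 0 := by
    decide +kernel
  exact key ⟨a, by omega⟩ ⟨b, by omega⟩ ⟨d, by omega⟩ hab had hbd habd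

section

variable {ι : Type*}

/-- The value of the certificate at a pair of words restricted to the coordinates in `T`. -/
def pairCertificate (T : Finset ι) (c x : ι → ZMod 2) : ℤ :=
  certificate #{t ∈ T | c t ≠ 0 ∧ x t ≠ 0} #{t ∈ T | c t = 0 ∧ x t ≠ 0}
    #{t ∈ T | c t ≠ 0 ∧ x t = 0}

theorem card_filter_ne_zero_split (T : Finset ι) (c x : ι → ZMod 2) :
    #{t ∈ T | c t ≠ 0 ∧ x t ≠ 0} + #{t ∈ T | c t = 0 ∧ x t ≠ 0} = #{t ∈ T | x t ≠ 0} := by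
  rw [← card_filter_add_card_filter_not (s := {t ∈ T | x t ≠ 0}) (fun t => c t ≠ 0),
    filter_filter, filter_filter]
  simp only [not_not, and_comm]

theorem card_filter_eq_zero_split (T : Finset ι) (c x : ι → ZMod 2) :
    #{t ∈ T | c t ≠ 0 ∧ x t = 0} + #{t ∈ T | c t = 0 ∧ x t = 0} = #{t ∈ T | x t = 0} := by
  rw [← card_filter_add_card_filter_not (s := {t ∈ T | x t = 0}) (fun t => c t ≠ 0),
    filter_filter, filter_filter]
  simp only [not_not, and_comm]

theorem pairCertificate_add_right (T : Finset ι) (c x : ι → ZMod 2) :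
    pairCertificate T x (c + x) = certificate #{t ∈ T | c t = 0 ∧ x t ≠ 0}
      #{t ∈ T | c t ≠ 0 ∧ x t = 0} #{t ∈ T | c t ≠ 0 ∧ x t ≠ 0} := by
  have h1 : ∀ y z : ZMod 2, z ≠ 0 ∧ y + z ≠ 0 ↔ y = 0 ∧ z ≠ 0 := by decide
  have h2 : ∀ y z : ZMod 2, z = 0 ∧ y + z ≠ 0 ↔ y ≠ 0 ∧ z = 0 := by decide
  have h3 : ∀ y z : ZMod 2, z ≠ 0 ∧ y + z = 0 ↔ y ≠ 0 ∧ z ≠ 0 := by decide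
  simp only [pairCertificate, Pi.add_apply, h1, h2, h3]

variable [DecidableEq ι] {M : Type*} [AddCommGroup M] [Fintype M]

theorem sum_krawtchoukCombination_nonneg (φ : M →+ ι → ZMod 2) {T : Finset ι} (hT : #T = 25)
    (l : List (ℕ × ℕ × ℕ)) (c : ι → ZMod 2) :
    0 ≤ ∑ x, krawtchoukCombination l #{t ∈ T | c t ≠ 0 ∧ φ x t ≠ 0}
      #{t ∈ T | c t = 0 ∧ φ x t ≠ 0} #{t ∈ T | c t ≠ 0 ∧ φ x t = 0} := by
  induction l with
  | nil => simp [krawtchoukCombination]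
  | cons r l ih =>
    simp only [krawtchoukCombination, List.map_cons, List.sum_cons, sum_add_distrib] at ih ⊢
    refine add_nonneg ?_ ih
    rw [← mul_sum]
    refine mul_nonneg (Int.natCast_nonneg _) ?_
    refine (sum_krawtchouk_mul_krawtchouk_nonneg φ
      (disjoint_filter_filter_not T T fun t => c t ≠ 0) r.1 r.2.1).trans_eq
      (sum_congr rfl fun x _ => ?_)
    have h1 := card_filter_ne_zero_split T c (φ x)
    have h2 := card_filter_eq_zero_split T c (φ x)
    have h3 := card_filter_add_card_filter_not (s := T) (fun t => φ x t = 0)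
    have h4 : #{t ∈ T | c t = 0 ∧ φ x t = 0} = 25 - #{t ∈ T | c t ≠ 0 ∧ φ x t ≠ 0} -
        #{t ∈ T | c t = 0 ∧ φ x t ≠ 0} - #{t ∈ T | c t ≠ 0 ∧ φ x t = 0} := by
      simp only [ne_eq] at *
      omega
    simp only [not_not, ne_eq, filter_filter] at h4 ⊢
    rw [h4]

theorem sum_pairCertificate_nonneg (φ : M →+ ι → ZMod 2) {T : Finset ι} (hT : #T = 25)
    (hM : Fintype.card M = 256 * #{x : M | #{t ∈ T | φ x t ≠ 0} = 0}) (c : M) :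
    0 ≤ ∑ x, pairCertificate T (φ c) (φ x) := by
  have hg : ∀ x, #{t ∈ T | φ c t ≠ 0 ∧ φ x t ≠ 0} + #{t ∈ T | φ c t ≠ 0 ∧ φ x t = 0} =
      #{t ∈ T | φ c t ≠ 0} := fun x => by
    rw [← card_filter_ne_zero_split T (φ x) (φ c)]
    simp only [and_comm]
  simp only [pairCertificate, certificate, hg, card_filter_ne_zero_split, sum_add_distrib,
    ← mul_sum, sum_sub_distrib]
  refine add_nonneg (sum_krawtchoukCombination_nonneg φ hT _ _) (le_of_eq ?_)
  rw [← sum_filter]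
  simp only [sum_const, card_univ, hM, nsmul_eq_mul]
  push_cast
  ring

/-- Linear programming bound: the words of a linear code of length 25 whose nonzero weights are
even and at least 10 cannot number 256. -/
theorem card_ne_of_even_weights (φ : M →+ ι → ZMod 2) {T : Finset ι} (hT : #T = 25)
    (hw : ∀ x, #{t ∈ T | φ x t ≠ 0} = 0 ∨
      10 ≤ #{t ∈ T | φ x t ≠ 0} ∧ #{t ∈ T | φ x t ≠ 0} % 2 = 0) :
    Fintype.card M ≠ 256 * #{x : M | #{t ∈ T | φ x t ≠ 0} = 0} := by
  intro hM
  let F : M × M → ℤ := fun p => pairCertificate T (φ p.1) (φ p.2)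
  let e : M × M ≃ M × M :=
    { toFun := fun p => (p.2, p.1 + p.2)
      invFun := fun p => (p.2 - p.1, p.1)
      left_inv := fun p => by simp
      right_inv := fun p => by simp }
  have h0 : 0 ≤ ∑ p, F p := by
    rw [Fintype.sum_prod_type]
    exact sum_nonneg fun c _ => sum_pairCertificate_nonneg φ hT hM c
  have h1 : ∑ p, F (e p) = ∑ p, F p := Equiv.sum_comp e F
  have h2 : ∑ p, F (e (e p)) = ∑ p, F p := (Equiv.sum_comp e fun p => F (e p)).trans h1
  have h3 : 0 ≤ ∑ p, (F p + F (e p) + F (e (e p))) := by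
    rw [sum_add_distrib, sum_add_distrib, h1, h2]
    linarith
  have h4 : ∑ p, (F p + F (e p) + F (e (e p))) < ∑ p : M × M, 0 := by
    have hF : ∀ c x : M, F (c, x) + F (e (c, x)) + F (e (e (c, x))) =
        certificate #{t ∈ T | φ c t ≠ 0 ∧ φ x t ≠ 0} #{t ∈ T | φ c t = 0 ∧ φ x t ≠ 0}
          #{t ∈ T | φ c t ≠ 0 ∧ φ x t = 0} +
        certificate #{t ∈ T | φ c t = 0 ∧ φ x t ≠ 0} #{t ∈ T | φ c t ≠ 0 ∧ φ x t = 0}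
          #{t ∈ T | φ c t ≠ 0 ∧ φ x t ≠ 0} +
        certificate #{t ∈ T | φ c t ≠ 0 ∧ φ x t = 0} #{t ∈ T | φ c t ≠ 0 ∧ φ x t ≠ 0}
          #{t ∈ T | φ c t = 0 ∧ φ x t ≠ 0} := by
      intro c x
      have h2 : ∀ y z : ZMod 2, z + (y + z) = y := by decide
      have hxx : φ x + (φ c + φ x) = φ c := funext fun t => h2 _ _
      have hcx := pairCertificate_add_right T (φ x) (φ c + φ x)
      have h5 : ∀ y z : ZMod 2, z = 0 ∧ y + z ≠ 0 ↔ y ≠ 0 ∧ z = 0 := by decide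
      have h6 : ∀ y z : ZMod 2, z ≠ 0 ∧ y + z = 0 ↔ y ≠ 0 ∧ z ≠ 0 := by decide
      have h7 : ∀ y z : ZMod 2, z ≠ 0 ∧ y + z ≠ 0 ↔ y = 0 ∧ z ≠ 0 := by decide
      simp only [Pi.add_apply, h5, h6, h7] at hcx
      simp only [F, e, Equiv.coe_fn_mk, map_add, pairCertificate_add_right T (φ c) (φ x), hcx]
      rfl
    refine sum_lt_sum (fun p _ => ?_) ⟨(0, 0), mem_univ _, ?_⟩
    · obtain ⟨c, x⟩ := p
      rw [hF]
      have hb := card_filter_ne_zero_split T (φ c) (φ x)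
      have hd := card_filter_eq_zero_split T (φ c) (φ x)
      have hx := card_filter_add_card_filter_not (s := T) (fun t => φ x t = 0)
      have hc := card_filter_ne_zero_split T (φ x) (φ c)
      have hs : #{t ∈ T | (φ c + φ x) t ≠ 0} =
          #{t ∈ T | φ c t = 0 ∧ φ x t ≠ 0} + #{t ∈ T | φ c t ≠ 0 ∧ φ x t = 0} := by
        have h8 : ∀ y z : ZMod 2, z ≠ 0 ∧ y + z ≠ 0 ↔ y = 0 ∧ z ≠ 0 := by decide
        have h9 : ∀ y z : ZMod 2, z = 0 ∧ y + z ≠ 0 ↔ y ≠ 0 ∧ z = 0 := by decide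
        rw [← card_filter_ne_zero_split T (φ x) (φ c + φ x)]
        simp only [Pi.add_apply, h8, h9]
      simp only [and_comm (a := φ x _ ≠ 0), and_comm (a := φ x _ = 0)] at hc
      have wx := hw x
      have wc := hw c
      have ws := hw (c + x)
      rw [map_add, hs] at ws
      rw [← hb] at wx
      rw [← hc] at wc
      refine certificate_rotation_nonpos wx wc ws ?_
      simp only [ne_eq] at *
      omega
    · rw [hF]
      simp [certificate, krawtchoukCombination, multipliers, cardMultiplier]
  simp only [sum_const_zero] at h4
  linarith

end
theorem sum_eq_card_filter_ne_zero {ι : Type*} (S : Finset ι) (x : ι → ZMod 2) :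
    ∑ t ∈ S, x t = (#{t ∈ S | x t ≠ 0} : ZMod 2) := by
  have h : ∀ y : ZMod 2, y = if y ≠ 0 then 1 else 0 := by decide
  rw [card_filter, Nat.cast_sum]
  refine sum_congr rfl fun t _ => (h (x t)).trans ?_
  push_cast
  rfl

/-- The weights of `x`, `c` and `c + x` in terms of the overlap of `x` with `c`. -/
theorem exists_hammingNorm_eq {ι : Type*} [Fintype ι] (c x : ι → ZMod 2) :
    ∃ a d, hammingNorm x = a + #{t ∈ ({t | c t = 0} : Finset ι) | x t ≠ 0} ∧
      hammingNorm c = a + d ∧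
      hammingNorm (c + x) = #{t ∈ ({t | c t = 0} : Finset ι) | x t ≠ 0} + d := by
  refine ⟨#{t | c t ≠ 0 ∧ x t ≠ 0}, #{t | c t ≠ 0 ∧ x t = 0}, ?_, ?_, ?_⟩
  · rw [filter_filter]
    exact (card_filter_ne_zero_split univ c x).symm
  · rw [hammingNorm, ← card_filter_ne_zero_split univ x c]
    simp only [and_comm]
  · have h1 : ∀ y z : ZMod 2, z ≠ 0 ∧ y + z ≠ 0 ↔ y = 0 ∧ z ≠ 0 := by decide
    have h2 : ∀ y z : ZMod 2, z = 0 ∧ y + z ≠ 0 ↔ y ≠ 0 ∧ z = 0 := by decide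
    rw [filter_filter, hammingNorm, ← card_filter_ne_zero_split univ x (c + x)]
    simp only [Pi.add_apply, h1, h2]

/-- Restriction of words to the coordinates other than `j`, with the coordinate `j` replaced by a
parity check on the coordinates in `S`. -/
def parityExtension {ι : Type*} [DecidableEq ι] (S : Finset ι) (j : ι) :
    (ι → ZMod 2) →+ ι → ZMod 2 where
  toFun x := Function.update x j (∑ t ∈ S, x t)
  map_zero' := by simp
  map_add' x y := by
    ext i
    by_cases h : i = j
    · subst h; simp [sum_add_distrib]
    · simp [h]

theorem card_filter_parityExtension_ne_zero {ι : Type*} [DecidableEq ι] (S : Finset ι) {j : ι}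
    (hj : j ∉ S) (x : ι → ZMod 2) :
    #{t ∈ insert j S | parityExtension S j x t ≠ 0} =
      #{t ∈ S | x t ≠ 0} + #{t ∈ S | x t ≠ 0} % 2 := by
  have h : {t ∈ S | parityExtension S j x t ≠ 0} = {t ∈ S | x t ≠ 0} :=
    filter_congr fun t ht => by
      have : t ≠ j := fun h => hj (h ▸ ht)
      simp [parityExtension, this]
  have hjS : parityExtension S j x j = (#{t ∈ S | x t ≠ 0} : ZMod 2) := by
    simp [parityExtension, sum_eq_card_filter_ne_zero]
  simp only [filter_insert, h, hjS, ne_eq, ZMod.natCast_eq_zero_iff_even, Nat.even_iff]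
  split_ifs with h2
  · omega
  · rw [card_insert_of_notMem (by simp [hj])]
    omega

theorem hammingNorm_ne_22 (C : Submodule (ZMod 2) (Fin 46 → ZMod 2))
    (hdim : Module.finrank (ZMod 2) C = 9)
    (hmin : ∀ c ∈ C, c ≠ 0 → 20 ≤ hammingNorm c) :
    ∀ c ∈ C, hammingNorm c ≠ 22 := by
  intro c hc hc22
  have hc0 : c ≠ 0 := by
    rintro rfl
    simp at hc22
  obtain ⟨j, hj⟩ := Function.ne_iff.mp hc0
  let S : Finset (Fin 46) := {t | c t = 0}
  have hjS : j ∉ S := by simpa [S] using hj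
  have hS : #S = 24 := by
    have h := card_filter_add_card_filter_not (s := (univ : Finset (Fin 46))) (fun t => c t = 0)
    have h' : #{t | ¬c t = 0} = 22 := hc22
    rw [h', card_univ, Fintype.card_fin] at h
    exact Nat.add_right_cancel h
  let φ : C →+ Fin 46 → ZMod 2 := (parityExtension S j).comp C.subtype.toAddMonoidHom
  have hφ : ∀ x : C, #{t ∈ insert j S | φ x t ≠ 0} =
      #{t ∈ S | x.1 t ≠ 0} + #{t ∈ S | x.1 t ≠ 0} % 2 :=
    fun x => card_filter_parityExtension_ne_zero S hjS x.1
  have hb : ∀ x : C, #{t ∈ S | x.1 t ≠ 0} = 0 ∧ (x = 0 ∨ x = ⟨c, hc⟩) ∨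
      9 ≤ #{t ∈ S | x.1 t ≠ 0} ∧ x ≠ 0 ∧ x ≠ ⟨c, hc⟩ := by
    intro x
    by_cases h0 : x = 0
    · left; simp [h0]
    by_cases h1 : x = ⟨c, hc⟩
    · left; simp [h1, S]
    right
    refine ⟨?_, h0, h1⟩
    have hx0 : x.1 ≠ 0 := fun h => h0 (Subtype.ext h)
    have hcx : c + x.1 ≠ 0 := fun h => h1 (Subtype.ext (CharTwo.add_eq_zero.mp h).symm)
    obtain ⟨a, d, ha, hd, hcd⟩ := exists_hammingNorm_eq c x.1
    have h2 := hmin _ x.2 hx0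
    have h3 := hmin _ (C.add_mem hc x.2) hcx
    change _ = a + #{t ∈ S | x.1 t ≠ 0} at ha
    change _ = #{t ∈ S | x.1 t ≠ 0} + d at hcd
    omega
  let := Fintype.ofFinite C
  refine card_ne_of_even_weights φ (T := insert j S) ?_ ?_ ?_
  · rw [card_insert_of_notMem hjS, hS]
  · intro x
    rw [hφ]
    rcases hb x with h | h <;> omega
  · have hz : ({x : C | #{t ∈ insert j S | φ x t ≠ 0} = 0} : Finset C) = {0, ⟨c, hc⟩} := by
      ext x
      rw [mem_filter, hφ, mem_insert, mem_singleton]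
      rcases hb x with ⟨h, h'⟩ | ⟨h, h1, h2⟩
      · simp [h, h']
      · simp only [mem_univ, true_and, h1, h2, or_self, iff_false]
        omega
    rw [hz, card_pair fun h => hc0 (congrArg Subtype.val h).symm,
      Module.card_eq_pow_finrank (K := ZMod 2), hdim, ZMod.card]
    rfl

theorem hammingNorm_ne_26 (C : Submodule (ZMod 2) (Fin 46 → ZMod 2))
    (hdim : Module.finrank (ZMod 2) C = 9)
    (hmin : ∀ c ∈ C, c ≠ 0 → 20 ≤ hammingNorm c) :
    ∀ c ∈ C, hammingNorm c ≠ 26 := by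
  intro c hc hc26
  have hne := hammingNorm_ne_22 C hdim hmin
  let S : Finset (Fin 46) := {t | c t = 0}
  have hS : #S = 20 := by
    have h := card_filter_add_card_filter_not (s := (univ : Finset (Fin 46))) (fun t => c t = 0)
    have h' : #{t | ¬c t = 0} = 26 := hc26
    rw [h', card_univ, Fintype.card_fin] at h
    exact Nat.add_right_cancel h
  let parity (A : Finset (Fin 46)) : C →ₗ[ZMod 2] ZMod 2 :=
    (∑ t ∈ A, LinearMap.proj t) ∘ₗ C.subtype
  let ψ : C →ₗ[ZMod 2] ZMod 2 × ZMod 2 := (parity univ).prod (parity S)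
  let := Fintype.ofFinite ψ.ker
  have hcard : 128 ≤ Fintype.card ψ.ker := by
    have h1 := ψ.finrank_range_add_finrank_ker
    have h2 := Submodule.finrank_le ψ.range
    rw [Module.finrank_prod, Module.finrank_self] at h2
    rw [Module.card_eq_pow_finrank (K := ZMod 2), ZMod.card]
    exact Nat.pow_le_pow_right (n := 2) (i := 7) two_pos (by omega)
  let φ : ψ.ker →+ Fin 46 → ZMod 2 := (C.subtype ∘ₗ ψ.ker.subtype).toAddMonoidHom
  have hparity : ∀ x : ψ.ker, hammingNorm (φ x) % 2 = 0 ∧ #{t ∈ S | φ x t ≠ 0} % 2 = 0 := by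
    intro x
    have h : ∑ t, φ x t = 0 ∧ ∑ t ∈ S, φ x t = 0 := by
      have hx : ψ x.1 = 0 := LinearMap.mem_ker.mp x.2
      simpa [-LinearMap.map_coe_ker, ψ, parity, φ] using hx
    simp only [sum_eq_card_filter_ne_zero, ZMod.natCast_eq_zero_iff_even,
      Nat.even_iff] at h
    exact h
  have hb : ∀ x : ψ.ker, #{t ∈ S | φ x t ≠ 0} = 0 ∧ (φ x = 0 ∨ φ x = c) ∨
      10 ≤ #{t ∈ S | φ x t ≠ 0} := by
    intro x
    by_cases h0 : φ x = 0
    · left; simp [h0]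
    by_cases h1 : φ x = c
    · left; simp [h1, S]
    right
    have hxC : φ x ∈ C := x.1.2
    have hcx : c + φ x ≠ 0 := fun h => h1 (CharTwo.add_eq_zero.mp h).symm
    obtain ⟨a, d, ha, hd, hcd⟩ := exists_hammingNorm_eq c (φ x)
    have h2 := hmin _ hxC h0
    have h3 := hmin _ (C.add_mem hc hxC) hcx
    have h4 := hne _ hxC
    have h5 := hne _ (C.add_mem hc hxC)
    have h6 := hparity x
    change _ = a + #{t ∈ S | φ x t ≠ 0} at ha
    change _ = #{t ∈ S | φ x t ≠ 0} + d at hcd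
    omega
  have hzero : #{x : ψ.ker | #{t ∈ S | φ x t ≠ 0} = 0} ≤ 2 := by
    refine (card_le_card_of_injOn (t := {0, c}) φ (fun x hx => ?_) fun x _ y _ h => ?_).trans
      card_le_two
    · have := hb x
      simp only [coe_filter, mem_univ, true_and, Set.mem_ofPred_eq] at hx
      rw [hx] at this
      simpa using this
    · exact Subtype.ext (Subtype.ext h)
  have hK (i : ℕ) : 0 ≤ ∑ x, krawtchouk #{t ∈ S | φ x t = 0} #{t ∈ S | φ x t ≠ 0} i := by
    simpa [krawtchouk_zero_right] using
      sum_krawtchouk_mul_krawtchouk_nonneg φ (disjoint_empty_right S) i 0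
  have hsum : 0 ≤ ∑ x, (2 * krawtchouk #{t ∈ S | φ x t = 0} #{t ∈ S | φ x t ≠ 0} 2 +
      20 * krawtchouk #{t ∈ S | φ x t = 0} #{t ∈ S | φ x t ≠ 0} 1) := by
    rw [sum_add_distrib, ← mul_sum, ← mul_sum]
    linarith [hK 1, hK 2]
  have hterm : ∀ x : ψ.ker, 2 * krawtchouk #{t ∈ S | φ x t = 0} #{t ∈ S | φ x t ≠ 0} 2 +
      20 * krawtchouk #{t ∈ S | φ x t = 0} #{t ∈ S | φ x t ≠ 0} 1 ≤
      (if #{t ∈ S | φ x t ≠ 0} = 0 then 800 else 0) - 20 := by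
    intro x
    have hp : #{t ∈ S | φ x t = 0} + #{t ∈ S | φ x t ≠ 0} = 20 :=
      (card_filter_add_card_filter_not _).trans hS
    have hp' : (#{t ∈ S | φ x t = 0} : ℤ) = 20 - #{t ∈ S | φ x t ≠ 0} := by
      linarith [(by exact_mod_cast hp :
        (#{t ∈ S | φ x t = 0} : ℤ) + #{t ∈ S | φ x t ≠ 0} = 20)]
    rw [two_mul_krawtchouk_two_right, krawtchouk_one_right, hp']
    rcases hb x with ⟨h, -⟩ | h
    · simp [h]
    · rw [if_neg (by omega)]
      have h1 : (10 : ℤ) ≤ #{t ∈ S | φ x t ≠ 0} := by exact_mod_cast h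
      have h2 : (#{t ∈ S | φ x t ≠ 0} : ℤ) ≤ 20 := by
        exact_mod_cast hp ▸ Nat.le_add_left _ _
      nlinarith [mul_nonneg (sub_nonneg.mpr h1) (sub_nonneg.mpr h2)]
  have htotal := hsum.trans (sum_le_sum fun x _ => hterm x)
  rw [sum_sub_distrib, ← sum_filter, sum_const, sum_const, card_univ, nsmul_eq_mul,
    nsmul_eq_mul] at htotal
  have h1 : (#{x : ψ.ker | #{t ∈ S | φ x t ≠ 0} = 0} : ℤ) ≤ 2 := by exact_mod_cast hzero
  have h2 : (128 : ℤ) ≤ Fintype.card ψ.ker := by exact_mod_cast hcard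
  linarith

/-- Every binary linear `[46, 9, ≥20]` code contains no codeword of Hamming
weight 22 and no codeword of Hamming weight 26. -/
theorem code_46_9_20_no_weight_22_or_26
    (C : Submodule (ZMod 2) (Fin 46 → ZMod 2))
    (hdim : Module.finrank (ZMod 2) C = 9)
    (hmin : ∀ c ∈ C, c ≠ 0 → 20 ≤ hammingNorm c) :
    ∀ c ∈ C, hammingNorm c ≠ 22 ∧ hammingNorm c ≠ 26 :=
  fun c hc => ⟨hammingNorm_ne_22 C hdim hmin c hc, hammingNorm_ne_26 C hdim hmin c hc⟩
end
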